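/- Let τ be in the complex upper half-plane, set q = e^{2πiτ}, and let u ∈ ℂ with u ∉ 2ℤτ + ℤ, z = e^{2πiu}. Then 2 z (q²;q²)_∞² C*(z;q²)³ (−z;q)_∞ (−z^{−1}q;q)_∞ = ( (1+z)δ_q + z + 2zδ_z + (1+z)δ_z² ) N*(1,1/q,z;q²), where δ_q := (2πi)^{−1}∂/∂τ and δ_z := (2πi)^{−1}∂/∂u act on (u,τ) ↦ N*(1,1/q,e^{2πiu}; e^{4πiτ}). -/

import Mathlib

open Complex Real Filter

noncomputable section

/-- The Jacobi theta function ϑ(u;τ) = Σ_{ν∈ℤ+1/2} e^{πiν²τ + 2πiν(u+1/2)}. -/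
def jTheta (u τ : ℂ) : ℂ :=
  ∑' n : ℤ, Complex.exp (π * I * ((n : ℂ) + 1/2)^2 * τ + 2 * π * I * ((n : ℂ) + 1/2) * (u + 1/2))

/-- ϑ₀(u;τ) = Σ_{n∈ℤ} e^{πin²τ + 2πinu}. -/
def jTheta0 (u τ : ℂ) : ℂ :=
  ∑' n : ℤ, Complex.exp (π * I * (n : ℂ)^2 * τ + 2 * π * I * (n : ℂ) * u)

/-- ϑ₁(u;τ) = Σ_{n∈1/2+ℤ} e^{πin²τ + 2πinu}. -/
def jTheta1 (u τ : ℂ) : ℂ :=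
  ∑' n : ℤ, Complex.exp (π * I * ((n : ℂ) + 1/2)^2 * τ + 2 * π * I * ((n : ℂ) + 1/2) * u)

/-- The Dedekind eta function. -/
def dedekindEta (τ : ℂ) : ℂ :=
  Complex.exp (π * I * τ / 12) * ∏' n : ℕ, (1 - Complex.exp (2 * π * I * ((n : ℂ) + 1) * τ))

/-- The Lerch sum μ(u,v;τ). -/
def lerchMu (u v τ : ℂ) : ℂ :=
  Complex.exp (π * I * u) / jTheta v τ *
    ∑' n : ℤ, (-1 : ℂ) ^ n * Complex.exp (π * I * ((n : ℂ)^2 + (n : ℂ)) * τ + 2 * π * I * v * (n : ℂ)) /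
      (1 - Complex.exp (2 * π * I * (n : ℂ) * τ + 2 * π * I * u))

/-- a₀^{α,β}(τ). -/
def aCoef0 (α β : ℝ) (τ : ℂ) : ℂ :=
  ∑' n : ℤ, ((n : ℂ) + (α : ℂ)/2) *
    Complex.exp (2 * π * I * (n : ℂ)^2 * τ + 2 * π * I * (n : ℂ) * ((α : ℂ) * τ + (β : ℂ)))

/-- a₁^{α,β}(τ). -/
def aCoef1 (α β : ℝ) (τ : ℂ) : ℂ :=
  ∑' n : ℤ, (((n : ℂ) + 1/2) + (α : ℂ)/2) *
    Complex.exp (2 * π * I * ((n : ℂ) + 1/2)^2 * τ + 2 * π * I * ((n : ℂ) + 1/2) * ((α : ℂ) * τ + (β : ℂ)))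

/-- Finite q-Pochhammer symbol (a;q)_n. -/
def qPochN (a q : ℂ) (n : ℕ) : ℂ := ∏ j ∈ Finset.range n, (1 - a * q ^ j)

/-- Infinite q-Pochhammer symbol (a;q)_∞. -/
def qPochInf (a q : ℂ) : ℂ := ∏' j : ℕ, (1 - a * q ^ j)

/-- The modified rank generating function R*(z;q). -/
def rankStar (z q : ℂ) : ℂ :=
  (qPochInf q q)⁻¹ * ∑' n : ℤ, (-1 : ℂ) ^ n * q ^ (n * (3 * n + 1) / 2) / (1 - z * q ^ n)

/-- The modified crank generating function C*(z;q). -/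
def crankStar (z q : ℂ) : ℂ :=
  (1 - z)⁻¹ * ∏' n : ℕ, ((1 - q ^ (n + 1)) / ((1 - z * q ^ (n + 1)) * (1 - z⁻¹ * q ^ (n + 1))))

/-- N(1,0,z;q), the overpartition-rank generating function. -/
def nGen10 (z q : ℂ) : ℂ :=
  ∑' n : ℕ, qPochN (-1) q n * q ^ (n * (n + 1) / 2) / (qPochN (z * q) q n * qPochN (z⁻¹ * q) q n)

/-- N*(1,0,z;q). -/
def nStar10 (z q : ℂ) : ℂ := nGen10 z q / (1 - z)

/-- N(1,1/q,z;q²), the M2-rank generating function for overpartitions. -/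
def nGenM2over (z q : ℂ) : ℂ :=
  ∑' n : ℕ, qPochN (-1) (q^2) n * qPochN (-q) (q^2) n * q ^ n /
    (qPochN (z * q^2) (q^2) n * qPochN (z⁻¹ * q^2) (q^2) n)

/-- N*(1,1/q,z;q²). -/
def nStarM2over (z q : ℂ) : ℂ := nGenM2over z q / (1 - z)

/-- N(0,1/q,z;q²), the M2-rank generating function for partitions without repeated odd parts. -/
def nGenM2 (z q : ℂ) : ℂ :=
  ∑' n : ℕ, qPochN (-q) (q^2) n * q ^ (n^2) /
    (qPochN (z * q^2) (q^2) n * qPochN (z⁻¹ * q^2) (q^2) n)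

/-- N*(0,1/q,z;q²). -/
def nStarM2 (z q : ℂ) : ℂ := nGenM2 z q / (1 - z)

/-- The odd-rank generating function R^o(z;q). -/
def oddRank (z q : ℂ) : ℂ :=
  (qPochInf (q^2) (q^2))⁻¹ * ∑' n : ℤ, (-1 : ℂ) ^ n * q ^ (3 * n^2 + 3 * n + 1) / (1 - z * q ^ (2 * n + 1))

section QPochhammer

variable {p : ℂ}

lemma summable_norm_mul_pow (hp : ‖p‖ < 1) (x : ℂ) : Summable fun j : ℕ => ‖-(x * p ^ j)‖ := by
  simpa using (summable_geometric_of_lt_one (norm_nonneg _) hp).mul_left ‖x‖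

lemma multipliable_qPoch (hp : ‖p‖ < 1) (x : ℂ) : Multipliable fun j : ℕ => 1 - x * p ^ j := by
  simpa [sub_eq_add_neg] using multipliable_one_add_of_summable (summable_norm_mul_pow hp x)

lemma qPochInf_eq_mul (hp : ‖p‖ < 1) (x : ℂ) :
    qPochInf x p = (1 - x) * qPochInf (x * p) p := by
  unfold qPochInf
  rw [tprod_eq_zero_mul' (f := fun j : ℕ => 1 - x * p ^ j)]
  · simp [pow_succ', mul_assoc]
  · simpa [pow_succ', mul_assoc] using multipliable_qPoch hp (x * p)

lemma qPochInf_eq_qPochN_mul (hp : ‖p‖ < 1) (x : ℂ) (n : ℕ) :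
    qPochInf x p = qPochN x p n * qPochInf (x * p ^ n) p := by
  induction n with
  | zero => simp [qPochN]
  | succ n ih =>
    rw [ih, qPochInf_eq_mul hp (x * p ^ n)]
    simp only [qPochN, Finset.prod_range_succ]
    ring_nf

lemma qPochN_succ (x : ℂ) (n : ℕ) : qPochN x p (n + 1) = qPochN x p n * (1 - x * p ^ n) := by
  simp [qPochN, Finset.prod_range_succ]

lemma qPochInf_zero (p : ℂ) : qPochInf 0 p = 1 := by simp [qPochInf]

lemma qPochInf_ne_zero (hp : ‖p‖ < 1) {x : ℂ} (h : ∀ j : ℕ, x * p ^ j ≠ 1) :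
    qPochInf x p ≠ 0 := by
  have := tprod_one_add_ne_zero_of_summable (f := fun j : ℕ => -(x * p ^ j))
    (fun j => by rw [← sub_eq_add_neg, sub_ne_zero]; exact (h j).symm) (summable_norm_mul_pow hp x)
  simpa [qPochInf, sub_eq_add_neg] using this

lemma qPochInf_ne_zero_of_norm_lt (hp : ‖p‖ < 1) {x : ℂ} (hx : ‖x‖ < 1) : qPochInf x p ≠ 0 := by
  refine qPochInf_ne_zero hp fun j h => ?_
  have : ‖x * p ^ j‖ < 1 := by
    rw [norm_mul, norm_pow]
    calc ‖x‖ * ‖p‖ ^ j ≤ ‖x‖ * 1 := by gcongr; exact pow_le_one₀ (norm_nonneg _) hp.le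
      _ < 1 := by simpa
  rw [h] at this
  simp at this

lemma differentiable_qPochInf (hp : ‖p‖ < 1) : Differentiable ℂ fun x => qPochInf x p := by
  intro x₀
  have hK : HasProdLocallyUniformlyOn (fun (j : ℕ) (x : ℂ) => 1 + -(x * p ^ j))
      (fun x => ∏' j : ℕ, (1 + -(x * p ^ j))) (Metric.ball 0 (‖x₀‖ + 1)) := by
    refine Summable.hasProdLocallyUniformlyOn_nat_one_add Metric.isOpen_ball
      (u := fun j => (‖x₀‖ + 1) * ‖p‖ ^ j)
      ((summable_geometric_of_lt_one (norm_nonneg _) hp).mul_left _) ?_ (fun _ => by fun_prop)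
    refine .of_forall fun n x hx => ?_
    rw [norm_neg, norm_mul, norm_pow]
    gcongr
    simpa using (mem_ball_zero_iff.mp hx).le
  have hd := hK.differentiableOn (.of_forall fun _ => by
    simpa [Finset.prod_fn] using DifferentiableOn.finsetProd (fun _ _ => by fun_prop))
    Metric.isOpen_ball
  have := hd.differentiableAt (Metric.isOpen_ball.mem_nhds (x := x₀) (by simp))
  simpa [qPochInf, sub_eq_add_neg] using this

lemma qPochInf_split (hp : ‖p‖ < 1) (x : ℂ) :
    qPochInf x p = qPochInf x (p ^ 2) * qPochInf (x * p) (p ^ 2) := by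
  have hp2 : ‖p ^ 2‖ < 1 := by rw [norm_pow]; exact pow_lt_one₀ (norm_nonneg _) hp two_ne_zero
  unfold qPochInf
  rw [← tprod_even_mul_odd (f := fun j : ℕ => 1 - x * p ^ j)]
  · simp [pow_mul, pow_succ', mul_assoc]
  · simpa [pow_mul] using multipliable_qPoch hp2 x
  · have := multipliable_qPoch hp2 (x * p)
    simpa [pow_mul, pow_succ', mul_assoc] using this

lemma qPochInf_mul_neg (hp : ‖p‖ < 1) (x : ℂ) :
    qPochInf x p * qPochInf (-x) p = qPochInf (x ^ 2) (p ^ 2) := by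
  unfold qPochInf
  rw [← (multipliable_qPoch hp x).tprod_mul (multipliable_qPoch hp (-x))]
  exact tprod_congr fun j => by ring

lemma exists_norm_qPochN_le (hp : ‖p‖ < 1) (x : ℂ) : ∃ C, ∀ n, ‖qPochN x p n‖ ≤ C := by
  have := (multipliable_qPoch hp x).hasProd.tendsto_prod_nat.norm.bddAbove_range
  obtain ⟨C, hC⟩ := this
  exact ⟨C, fun n => hC ⟨n, rfl⟩⟩

/-- `-q;q` and `q;q²` are inverse to each other (Euler). -/
lemma qPochInf_neg_mul_odd (hp : ‖p‖ < 1) : qPochInf (-p) p * qPochInf p (p ^ 2) = 1 := by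
  have h1 := qPochInf_mul_neg hp p
  have h2 := qPochInf_split hp p
  have hp2 : ‖p ^ 2‖ < 1 := by rw [norm_pow]; exact pow_lt_one₀ (norm_nonneg _) hp two_ne_zero
  have h3 := qPochInf_ne_zero_of_norm_lt hp2 hp2
  rw [h2, ← pow_two] at h1
  exact mul_right_cancel₀ h3 (by linear_combination h1)

end QPochhammer

section Gauss

lemma tsum_telescope {G : ℕ → ℂ} (hG : Summable G) : ∑' n, (G (n + 1) - G n) = -G 0 := by
  rw [((summable_nat_add_iff 1).2 hG).tsum_sub hG, hG.tsum_eq_zero_add]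
  ring

lemma exists_norm_qPochInf_le {p : ℂ} (hp : ‖p‖ < 1) (R : ℝ) :
    ∃ C, 0 ≤ C ∧ ∀ x : ℂ, ‖x‖ ≤ R → ‖qPochInf x p‖ ≤ C := by
  obtain ⟨C, hC⟩ := (isCompact_closedBall (0 : ℂ) R).exists_bound_of_continuousOn
    (differentiable_qPochInf hp).continuous.continuousOn
  exact ⟨max C 0, le_max_right _ _, fun x hx => (hC x (by simpa using hx)).trans (le_max_left _ _)⟩

variable {q : ℂ}

lemma norm_sq_lt_one (hq : ‖q‖ < 1) : ‖q ^ 2‖ < 1 := by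
  rw [norm_pow]; exact pow_lt_one₀ (norm_nonneg _) hq two_ne_zero

/-- Coefficients of the `₂φ₁` series with numerator parameters `-1, -q` in base `q²`. -/
def gaussCoeff (q : ℂ) (n : ℕ) : ℂ :=
  qPochN (-1) (q ^ 2) n * qPochN (-q) (q ^ 2) n / qPochN (q ^ 2) (q ^ 2) n

lemma qPochN_self_ne_zero {p : ℂ} (hp : ‖p‖ < 1) (n : ℕ) : qPochN p p n ≠ 0 := by
  have h := qPochInf_ne_zero_of_norm_lt hp hp
  rw [qPochInf_eq_qPochN_mul hp p n] at h
  exact left_ne_zero_of_mul h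

lemma exists_norm_gaussCoeff_le (hq : ‖q‖ < 1) : ∃ C, 0 ≤ C ∧ ∀ n, ‖gaussCoeff q n‖ ≤ C := by
  have hp := norm_sq_lt_one hq
  obtain ⟨A, hA⟩ := exists_norm_qPochN_le hp (-1)
  obtain ⟨B, hB⟩ := exists_norm_qPochN_le hp (-q)
  obtain ⟨D, hD0, hD⟩ := exists_norm_qPochInf_le hp 1
  have hA0 : 0 ≤ A := (norm_nonneg _).trans (hA 0)
  have hB0 : 0 ≤ B := (norm_nonneg _).trans (hB 0)
  have h0 := qPochInf_ne_zero_of_norm_lt hp hp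
  refine ⟨A * B * (D / ‖qPochInf (q ^ 2) (q ^ 2)‖), by positivity, fun n => ?_⟩
  have hn := qPochN_self_ne_zero hp n
  have : gaussCoeff q n = qPochN (-1) (q ^ 2) n * qPochN (-q) (q ^ 2) n *
      (qPochInf (q ^ 2 * (q ^ 2) ^ n) (q ^ 2) / qPochInf (q ^ 2) (q ^ 2)) := by
    rw [gaussCoeff]
    have h1 := qPochInf_eq_qPochN_mul hp (q ^ 2) n
    field_simp
    rw [h1]
    ring
  rw [this, norm_mul, norm_mul, norm_div]
  gcongr
  · exact hA n
  · exact hB n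
  · apply hD
    rw [← pow_succ', norm_pow]
    exact pow_le_one₀ (norm_nonneg _) hp.le

lemma gaussCoeff_succ (hq : ‖q‖ < 1) (n : ℕ) :
    gaussCoeff q (n + 1) * (1 - (q ^ 2) ^ (n + 1)) =
      gaussCoeff q n * ((1 + (q ^ 2) ^ n) * (1 + q * (q ^ 2) ^ n)) := by
  have hp := norm_sq_lt_one hq
  have h1 := qPochN_self_ne_zero hp n
  have h2 := qPochN_self_ne_zero hp (n + 1)
  simp only [gaussCoeff]
  rw [div_mul_eq_mul_div, div_mul_eq_mul_div, div_eq_div_iff h2 h1]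
  simp only [qPochN_succ]
  ring

/-- The series `∑ (-1)ₙ(-q)ₙ/(q²)ₙ · (qwq²ⁿ)_∞ wⁿ` in base `q²`. -/
def gaussSeries (q w : ℂ) : ℂ :=
  ∑' n : ℕ, gaussCoeff q n * qPochInf (q * w * (q ^ 2) ^ n) (q ^ 2) * w ^ n

lemma exists_norm_gaussTerm_le (hq : ‖q‖ < 1) :
    ∃ C, ∀ n : ℕ, ∀ x w : ℂ, ‖x‖ ≤ 1 →
      ‖gaussCoeff q n * qPochInf x (q ^ 2) * w ^ n‖ ≤ C * ‖w‖ ^ n := by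
  obtain ⟨A, hA0, hA⟩ := exists_norm_gaussCoeff_le hq
  obtain ⟨D, hD0, hD⟩ := exists_norm_qPochInf_le (norm_sq_lt_one hq) 1
  refine ⟨A * D, fun n x w hx => ?_⟩
  rw [norm_mul, norm_mul, norm_pow]
  gcongr
  exacts [hA n, hD x hx]

lemma norm_mul_pow_le_one (hq : ‖q‖ < 1) {w : ℂ} (hw : ‖w‖ < 1) (n : ℕ) :
    ‖q * w * (q ^ 2) ^ n‖ ≤ 1 := by
  rw [norm_mul, norm_mul, norm_pow]
  exact mul_le_one₀ (mul_le_one₀ hq.le (norm_nonneg _) hw.le) (by positivity)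
    (pow_le_one₀ (norm_nonneg _) (norm_sq_lt_one hq).le)

lemma gaussSeries_step (hq : ‖q‖ < 1) {w : ℂ} (hw : ‖w‖ < 1) :
    (1 - w) * gaussSeries q w = (1 + q * w) * (1 + w) * gaussSeries q (w * q ^ 2) := by
  have hp := norm_sq_lt_one hq
  have hw' : ‖w * q ^ 2‖ < 1 := by
    rw [norm_mul]; exact mul_lt_one_of_nonneg_of_lt_one_left (norm_nonneg _) hw hp.le
  obtain ⟨C, hC⟩ := exists_norm_gaussTerm_le hq
  have key : ∀ v : ℂ, ‖v‖ < 1 →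
      Summable fun n : ℕ => gaussCoeff q n * qPochInf (q * v * (q ^ 2) ^ n) (q ^ 2) * v ^ n :=
    fun v hv => .of_norm_bounded ((summable_geometric_of_lt_one (norm_nonneg v) hv).mul_left C)
      fun n => hC n _ _ (norm_mul_pow_le_one hq hv n)
  have hG : Summable fun n : ℕ => -(1 - (q ^ 2) ^ n) *
      (gaussCoeff q n * qPochInf (q * w * (q ^ 2) ^ n) (q ^ 2) * w ^ n) := by
    have h1 := key w hw
    have h2 : Summable fun n : ℕ => (q ^ 2) ^ n *
        (gaussCoeff q n * qPochInf (q * w * (q ^ 2) ^ n) (q ^ 2) * w ^ n) := by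
      refine .of_norm_bounded h1.norm fun n => ?_
      rw [norm_mul, norm_pow]
      exact mul_le_of_le_one_left (norm_nonneg _) (pow_le_one₀ (norm_nonneg _) hp.le)
    exact (h2.sub h1).congr fun n => by ring
  have ht := tsum_telescope hG
  have h0 : (1 - w) * gaussSeries q w - (1 + q * w) * (1 + w) * gaussSeries q (w * q ^ 2) = 0 := by
    unfold gaussSeries
    rw [← tsum_mul_left, ← tsum_mul_left,
      ← ((key w hw).mul_left _).tsum_sub ((key _ hw').mul_left _)]
    refine Eq.trans (tsum_congr fun n => ?_) (ht.trans (by simp))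
    have e1 := qPochInf_eq_mul hp (q * w * (q ^ 2) ^ n)
    have e2 : q * w * (q ^ 2) ^ n * q ^ 2 = q * w * (q ^ 2) ^ (n + 1) := by ring
    have e3 : q * (w * q ^ 2) * (q ^ 2) ^ n = q * w * (q ^ 2) ^ (n + 1) := by ring
    rw [e2] at e1
    rw [e1, e3]
    have e4 := gaussCoeff_succ hq n
    linear_combination qPochInf (q * w * (q ^ 2) ^ (n + 1)) (q ^ 2) * w ^ (n + 1) * e4
  linear_combination h0

lemma gaussSeries_mul (hq : ‖q‖ < 1) {w : ℂ} (hw : ‖w‖ < 1) :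
    gaussSeries q w * qPochInf w (q ^ 2) = qPochInf (-(q * w)) (q ^ 2) * qPochInf (-w) (q ^ 2) := by
  have hp := norm_sq_lt_one hq
  set φ := fun x => qPochInf x (q ^ 2) with hφ
  have hφd : Differentiable ℂ φ := differentiable_qPochInf hp
  have hφc := hφd.continuous
  set g := fun w => gaussSeries q w * φ w / (φ (-(q * w)) * φ (-w)) with hg
  have hne : ∀ w : ℂ, ‖w‖ < 1 → φ (-(q * w)) * φ (-w) ≠ 0 := fun w hw =>
    mul_ne_zero (qPochInf_ne_zero_of_norm_lt hp (by
      rw [norm_neg, norm_mul]; exact mul_lt_one_of_nonneg_of_lt_one_left (norm_nonneg _) hq hw.le))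
      (qPochInf_ne_zero_of_norm_lt hp (by rwa [norm_neg]))
  have hnw : ∀ w : ℂ, ‖w‖ < 1 → ‖w * q ^ 2‖ < 1 := fun w hw => by
    rw [norm_mul]; exact mul_lt_one_of_nonneg_of_lt_one_left (norm_nonneg _) hw hp.le
  have hstep : ∀ w : ℂ, ‖w‖ < 1 → g (w * q ^ 2) = g w := fun w hw => by
    have h1 := gaussSeries_step hq hw
    have e1 : φ w = (1 - w) * φ (w * q ^ 2) := qPochInf_eq_mul hp w
    have e2 : φ (-w) = (1 + w) * φ (-(w * q ^ 2)) := by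
      have := qPochInf_eq_mul hp (-w)
      simpa [hφ, neg_mul] using this
    have e3 : φ (-(q * w)) = (1 + q * w) * φ (-(q * (w * q ^ 2))) := by
      have := qPochInf_eq_mul hp (-(q * w))
      simpa [hφ, neg_mul, mul_assoc] using this
    simp only [hg]
    rw [div_eq_div_iff (hne _ (hnw w hw)) (hne _ hw), e1, e2, e3]
    linear_combination -(φ (-(w * q ^ 2)) * φ (-(q * (w * q ^ 2))) * φ (w * q ^ 2)) * h1
  have hiter : ∀ k : ℕ, ‖w * (q ^ 2) ^ k‖ < 1 ∧ g (w * (q ^ 2) ^ k) = g w := by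
    intro k
    induction k with
    | zero => simpa using hw
    | succ k ih =>
      rw [pow_succ, ← mul_assoc]
      exact ⟨hnw _ ih.1, (hstep _ ih.1).trans ih.2⟩
  have hΨ : ContinuousAt (gaussSeries q) 0 := by
    obtain ⟨C, hC⟩ := exists_norm_gaussTerm_le hq
    have hC0 : 0 ≤ C := by simpa using (norm_nonneg _).trans (hC 0 0 0 (by simp))
    have hd : DifferentiableOn ℂ (gaussSeries q) (Metric.ball 0 (1 / 2)) := by
      refine differentiableOn_tsum_of_summable_norm
        (u := fun n : ℕ => C * (1 / 2) ^ n)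
        ((summable_geometric_of_lt_one (by norm_num) (by norm_num)).mul_left C) (fun n => ?_)
        Metric.isOpen_ball fun n v hv => ?_
      · have : Differentiable ℂ fun v : ℂ => φ (q * v * (q ^ 2) ^ n) :=
          hφd.comp (by fun_prop)
        exact ((this.const_mul (gaussCoeff q n)).mul (by fun_prop)).differentiableOn
      · have hv' : ‖v‖ < 1 / 2 := by simpa using hv
        refine (hC n _ v (norm_mul_pow_le_one hq (by linarith) n)).trans ?_
        gcongr
    exact (hd.differentiableAt (Metric.ball_mem_nhds _ (by norm_num))).continuousAt
  have hg0 : ContinuousAt g 0 :=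
    (hΨ.mul hφc.continuousAt).div
      ((hφc.comp (by fun_prop)).continuousAt.mul (hφc.comp (by fun_prop)).continuousAt)
      (hne 0 (by simp))
  have hlim : Tendsto (fun k : ℕ => g (w * (q ^ 2) ^ k)) atTop (nhds (g 0)) := by
    refine hg0.tendsto.comp ?_
    simpa using (tendsto_pow_atTop_nhds_zero_of_norm_lt_one hp).const_mul w
  have h00 : g 0 = 1 := by
    have : gaussSeries q 0 = 1 := by
      unfold gaussSeries
      rw [tsum_eq_single 0 (fun n hn => by simp [hn])]
      simp [gaussCoeff, qPochN, qPochInf_zero]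
    simp [hg, this, hφ, qPochInf_zero]
  have hgw : g w = 1 := by
    rw [← h00]
    refine tendsto_nhds_unique ?_ hlim
    simp only [(hiter _).2]
    exact tendsto_const_nhds
  exact (div_eq_one_iff_eq (hne w hw)).1 hgw

/-- Coefficients of the `M₂`-rank generating function. -/
def m2Coeff (q : ℂ) (n : ℕ) : ℂ :=
  qPochN (-1) (q ^ 2) n * qPochN (-q) (q ^ 2) n * q ^ n

lemma tsum_m2Coeff_mul_sq (hq : ‖q‖ < 1) :
    ∑' n, m2Coeff q n * (qPochInf ((q ^ 2) ^ (n + 1)) (q ^ 2) *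
      qPochInf ((q ^ 2) ^ (n + 1)) (q ^ 2)) =
      qPochInf (q ^ 2) (q ^ 2) * qPochInf (-q) q ^ 2 := by
  have hp := norm_sq_lt_one hq
  have h1 := gaussSeries_mul hq hq
  have h2 := qPochInf_split hq (-q)
  have h3 := qPochInf_neg_mul_odd hq
  have h4 : gaussSeries q q = qPochInf (-q) q ^ 2 := by
    have e : -(q * q) = -q * q := by ring
    rw [e, mul_comm (qPochInf (-q * q) _), ← h2] at h1
    calc gaussSeries q q = gaussSeries q q * (qPochInf (-q) q * qPochInf q (q ^ 2)) := by
          rw [h3, mul_one]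
      _ = _ := by linear_combination qPochInf (-q) q * h1
  rw [← h4, gaussSeries, ← tsum_mul_left]
  refine tsum_congr fun n => ?_
  have hn := qPochN_self_ne_zero hp n
  have e1 := qPochInf_eq_qPochN_mul hp (q ^ 2) n
  have e2 : q * q * (q ^ 2) ^ n = (q ^ 2) ^ (n + 1) := by ring
  have e3 : q ^ 2 * (q ^ 2) ^ n = (q ^ 2) ^ (n + 1) := by ring
  rw [e3] at e1
  rw [e2, m2Coeff, gaussCoeff, e1]
  field_simp

end Gauss

section Theta

/-- `ex u = e^{2πiu}`. -/
def ex (u : ℂ) : ℂ := Complex.exp (2 * π * I * u)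

lemma ex_ne_zero (u : ℂ) : ex u ≠ 0 := Complex.exp_ne_zero _

lemma ex_zero : ex 0 = 1 := by simp [ex]

lemma ex_add (u v : ℂ) : ex (u + v) = ex u * ex v := by
  simp [ex, mul_add, Complex.exp_add]

lemma ex_neg (u : ℂ) : ex (-u) = (ex u)⁻¹ := by
  simp [ex, Complex.exp_neg]

lemma ex_int_mul (n : ℤ) (u : ℂ) : ex (n * u) = ex u ^ n := by
  rw [ex, ex, ← Complex.exp_int_mul]; congr 1; ring

lemma ex_int (n : ℤ) : ex n = 1 := by
  rw [ex, mul_comm]; exact Complex.exp_int_mul_two_pi_mul_I n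

lemma ex_one : ex 1 = 1 := by simpa using ex_int 1

lemma ex_half : ex (1 / 2) = -1 := by
  rw [ex, ← Complex.exp_pi_mul_I]; congr 1; ring

lemma ex_two_mul (u : ℂ) : ex (2 * u) = ex u ^ 2 := by
  rw [two_mul, ex_add, pow_two]

lemma ex_eq_one_iff (u : ℂ) : ex u = 1 ↔ ∃ n : ℤ, u = n := by
  rw [ex, Complex.exp_eq_one_iff]
  have : (2 * π * I : ℂ) ≠ 0 := Complex.two_pi_I_ne_zero
  refine exists_congr fun n => ?_
  rw [mul_comm (n : ℂ)]
  exact mul_right_inj' this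

lemma norm_ex (u : ℂ) : ‖ex u‖ = Real.exp (-(2 * π * u.im)) := by
  rw [ex, Complex.norm_exp]
  congr 1
  simp

lemma norm_ex_lt_one {T : ℂ} (hT : 0 < T.im) : ‖ex T‖ < 1 := by
  rw [norm_ex, Real.exp_lt_one_iff]
  have := Real.pi_pos
  nlinarith [mul_pos this hT]

lemma hasDerivAt_ex (u : ℂ) : HasDerivAt ex (2 * π * I * ex u) u := by
  have h : HasDerivAt (fun u : ℂ => 2 * π * I * u) (2 * π * I) u := by
    simpa using (hasDerivAt_id u).const_mul (2 * π * I : ℂ)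
  exact h.cexp.congr_deriv (by rw [ex]; ring)

lemma differentiable_ex : Differentiable ℂ ex := fun u => (hasDerivAt_ex u).differentiableAt

lemma lattice_induction {T : ℂ} {P : ℂ → Prop} (h0 : P 0) (h1 : ∀ u, P (u + 1) ↔ P u)
    (hT : ∀ u, P (u + T) ↔ P u) (m n : ℤ) : P (m * T + n) := by
  have hm : ∀ m : ℤ, P (m * T) := by
    intro m
    induction m with
    | zero => simpa using h0
    | succ i ih => push_cast at ih ⊢; rw [add_mul, one_mul, hT]; exact ih
    | pred i ih =>
      rw [← hT]; push_cast at ih ⊢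
      rwa [show (-(i : ℂ) - 1) * T + T = -(i : ℂ) * T by ring]
  induction n with
  | zero => simpa using hm m
  | succ i ih => push_cast at ih ⊢; rw [← add_assoc, h1]; exact ih
  | pred i ih =>
    rw [← h1]; push_cast at ih ⊢
    rwa [show m * T + (-(i : ℂ) - 1) + 1 = m * T + -(i : ℂ) by ring]

/-- An entire doubly periodic function is constant. -/
lemma eq_const_of_periodic {g : ℂ → ℂ} {T : ℂ} (hT : 0 < T.im) (hg : Differentiable ℂ g)
    (h1 : ∀ u, g (u + 1) = g u) (h2 : ∀ u, g (u + T) = g u) (u : ℂ) : g u = g 0 := by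
  refine hg.apply_eq_apply_of_bounded ?_ u 0
  have hcomp : IsCompact ((fun x : ℝ × ℝ => g (x.1 * T + x.2)) '' (Set.Icc 0 1 ×ˢ Set.Icc 0 1)) :=
    (isCompact_Icc.prod isCompact_Icc).image (hg.continuous.comp (by fun_prop))
  refine hcomp.isBounded.subset ?_
  rintro _ ⟨v, rfl⟩
  set y : ℝ := v.im / T.im with hy
  set x : ℝ := v.re - y * T.re with hx
  have hv : v = y * T + x := by
    apply Complex.ext
    · simp [hx]
    · simp [hy, hT.ne']
  refine ⟨(Int.fract y, Int.fract x), ⟨⟨Int.fract_nonneg _, (Int.fract_lt_one _).le⟩,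
    ⟨Int.fract_nonneg _, (Int.fract_lt_one _).le⟩⟩, ?_⟩
  have key := lattice_induction (T := T)
    (P := fun w => g ((Int.fract y : ℝ) * T + (Int.fract x : ℝ) + w) =
      g ((Int.fract y : ℝ) * T + (Int.fract x : ℝ))) (by simp)
    (fun u => by rw [← add_assoc, h1]) (fun u => by rw [← add_assoc, h2]) ⌊y⌋ ⌊x⌋
  have e : ((Int.fract y : ℝ) : ℂ) * T + (Int.fract x : ℝ) + (⌊y⌋ * T + ⌊x⌋) = v := by
    rw [hv]
    have e1 : ((Int.fract y : ℝ) : ℂ) = y - ⌊y⌋ := by rw [Int.fract]; push_cast; rfl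
    have e2 : ((Int.fract x : ℝ) : ℂ) = x - ⌊x⌋ := by rw [Int.fract]; push_cast; rfl
    rw [e1, e2]; ring
  rw [e] at key
  exact key.symm

/-- An entire function antiperiodic under `1` and periodic under `T` vanishes. -/
lemma eq_zero_of_antiperiodic {g : ℂ → ℂ} {T : ℂ} (hT : 0 < T.im) (hg : Differentiable ℂ g)
    (h1 : ∀ u, g (u + 1) = -g u) (h2 : ∀ u, g (u + T) = g u) (u : ℂ) : g u = 0 := by
  have hc : ∀ v, g (2 * v) = g 0 := fun v => by
    have := eq_const_of_periodic (g := fun v => g (2 * v)) hT (hg.comp (by fun_prop))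
      (fun w => by
        rw [show 2 * (w + 1) = 2 * w + 1 + 1 by ring, h1, h1, neg_neg])
      (fun w => by rw [show 2 * (w + T) = 2 * w + T + T by ring, h2, h2]) v
    simpa using this
  have e : ∀ v, g v = g 0 := fun v => by
    have := hc (v / 2)
    rwa [mul_div_cancel₀ _ (two_ne_zero)] at this
  have h3 := h1 u
  rw [e (u + 1), e u] at h3
  rw [e u]
  exact self_eq_neg.1 h3

/-- Division of entire functions when the denominator has simple zeros, all shared by the
numerator. -/
lemma exists_entire_quotient {X Y : ℂ → ℂ} (hX : Differentiable ℂ X) (hY : Differentiable ℂ Y)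
    (h : ∀ a, Y a = 0 → X a = 0 ∧ deriv Y a ≠ 0) :
    ∃ g : ℂ → ℂ, Differentiable ℂ g ∧ ∀ u, X u = g u * Y u := by
  classical
  refine ⟨fun u => if Y u = 0 then deriv X u / deriv Y u else X u / Y u, fun a => ?_, fun u => ?_⟩
  · by_cases ha : Y a = 0
    · obtain ⟨hXa, hYa⟩ := h a ha
      have dX : Differentiable ℂ (dslope X a) := fun z =>
        ((Complex.differentiableOn_dslope univ_mem).2 hX.differentiableOn).differentiableAt univ_mem
      have dY : Differentiable ℂ (dslope Y a) := fun z =>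
        ((Complex.differentiableOn_dslope univ_mem).2 hY.differentiableOn).differentiableAt univ_mem
      have hne : ∀ᶠ z in nhds a, dslope Y a z ≠ 0 :=
        dY.continuous.continuousAt.eventually_ne (by rwa [dslope_same])
      have hq : DifferentiableAt ℂ (fun z => dslope X a z / dslope Y a z) a :=
        (dX a).div (dY a) hne.self_of_nhds
      refine hq.congr_of_eventuallyEq ?_
      filter_upwards [hne] with z hz
      by_cases hza : z = a
      · subst hza
        simp [ha, dslope_same]
      · have eX : X z = (z - a) * dslope X a z := by
          have := sub_smul_dslope X a z
          rw [hXa, sub_zero, smul_eq_mul] at this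
          exact this.symm
        have eY : Y z = (z - a) * dslope Y a z := by
          have := sub_smul_dslope Y a z
          rw [ha, sub_zero, smul_eq_mul] at this
          exact this.symm
        have hza' : z - a ≠ 0 := sub_ne_zero.2 hza
        have : Y z ≠ 0 := by rw [eY]; exact mul_ne_zero hza' hz
        rw [if_neg this, eX, eY, mul_div_mul_left _ _ hza']
    · have hne := hY.continuous.continuousAt.eventually_ne ha
      refine ((hX a).div (hY a) ha).congr_of_eventuallyEq ?_
      filter_upwards [hne] with z hz
      rw [if_neg hz]; rfl
  · by_cases hu : Y u = 0
    · rw [(h u hu).1, hu, mul_zero]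
    · simp only [if_neg hu]
      rw [div_mul_cancel₀ _ hu]

/-- The theta product `(z;p)_∞ (p/z;p)_∞` with `z = e^{2πiu}`, `p = e^{2πiT}`. -/
def thetaProd (T u : ℂ) : ℂ :=
  qPochInf (ex u) (ex T) * qPochInf ((ex u)⁻¹ * ex T) (ex T)

variable {T : ℂ}

lemma differentiable_qPochInf_ex (hT : 0 < T.im) (a : ℂ) :
    Differentiable ℂ fun u => qPochInf (ex u * a) (ex T) :=
  (differentiable_qPochInf (norm_ex_lt_one hT)).comp (differentiable_ex.mul_const a)

lemma differentiable_qPochInf_ex_inv (hT : 0 < T.im) (a : ℂ) :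
    Differentiable ℂ fun u => qPochInf ((ex u)⁻¹ * a) (ex T) :=
  (differentiable_qPochInf (norm_ex_lt_one hT)).comp
    ((differentiable_ex.inv ex_ne_zero).mul_const a)

lemma differentiable_thetaProd (hT : 0 < T.im) : Differentiable ℂ (thetaProd T) := by
  have h1 := differentiable_qPochInf_ex hT 1
  simp only [mul_one] at h1
  exact h1.mul (differentiable_qPochInf_ex_inv hT _)

lemma thetaProd_add_one (u : ℂ) : thetaProd T (u + 1) = thetaProd T u := by
  simp [thetaProd, ex_add, ex_one]

lemma thetaProd_eq (hT : 0 < T.im) (u : ℂ) : thetaProd T u =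
    (1 - ex u) * (qPochInf (ex u * ex T) (ex T) * qPochInf ((ex u)⁻¹ * ex T) (ex T)) := by
  rw [thetaProd, qPochInf_eq_mul (norm_ex_lt_one hT), mul_assoc]

lemma thetaProd_add (hT : 0 < T.im) (u : ℂ) :
    thetaProd T (u + T) = -(ex u)⁻¹ * thetaProd T u := by
  have h := ex_ne_zero u
  have hTne := ex_ne_zero T
  rw [thetaProd_eq hT u, thetaProd, ex_add]
  have e : (ex u * ex T)⁻¹ * ex T = (ex u)⁻¹ := by field_simp
  rw [e, qPochInf_eq_mul (norm_ex_lt_one hT) (ex u)⁻¹]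
  field_simp
  ring

lemma thetaProd_eq_zero_iff (hT : 0 < T.im) (u : ℂ) :
    thetaProd T u = 0 ↔ ∃ m n : ℤ, u = m * T + n := by
  constructor
  · intro h
    have key : ∃ m : ℤ, ex (u - m * T) = 1 := by
      by_contra! hne
      refine (mul_ne_zero (qPochInf_ne_zero (norm_ex_lt_one hT) fun j hj => ?_)
        (qPochInf_ne_zero (norm_ex_lt_one hT) fun j hj => ?_)) h
      · refine hne (-j) ?_
        rw [sub_eq_add_neg, ← neg_mul, ← Int.cast_neg, neg_neg, ex_add, ex_int_mul]
        simpa using hj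
      · refine hne (j + 1) ?_
        have e : ex ((j + 1 : ℤ) * T) = ex u := by
          rw [ex_int_mul]
          have hu := ex_ne_zero u
          field_simp at hj
          rw [← hj]
          norm_cast
          rw [pow_succ']
        rw [sub_eq_add_neg, ex_add, ex_neg, e, mul_inv_cancel₀ (ex_ne_zero u)]
    obtain ⟨m, hm⟩ := key
    obtain ⟨n, hn⟩ := (ex_eq_one_iff _).1 hm
    exact ⟨m, n, by linear_combination hn⟩
  · rintro ⟨m, n, rfl⟩
    refine lattice_induction (T := T) (P := fun u => thetaProd T u = 0) ?_ (fun u => ?_)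
      (fun u => ?_) m n
    · rw [thetaProd_eq hT]; simp [ex_zero]
    · simp only [thetaProd_add_one]
    · simp only [thetaProd_add hT]; simp [ex_ne_zero]

lemma hasDerivAt_thetaProd_zero (hT : 0 < T.im) :
    HasDerivAt (thetaProd T) (-(2 * π * I) * qPochInf (ex T) (ex T) ^ 2) 0 := by
  have hW : DifferentiableAt ℂ (fun u => qPochInf (ex u * ex T) (ex T) *
      qPochInf ((ex u)⁻¹ * ex T) (ex T)) 0 :=
    (differentiable_qPochInf_ex hT _ 0).mul (differentiable_qPochInf_ex_inv hT _ 0)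
  have h := ((hasDerivAt_ex 0).const_sub 1).mul hW.hasDerivAt
  have e : thetaProd T = (fun u => 1 - ex u) * fun u => qPochInf (ex u * ex T) (ex T) *
      qPochInf ((ex u)⁻¹ * ex T) (ex T) := funext fun u => thetaProd_eq hT u
  rw [e]
  refine h.congr_deriv ?_
  simp [ex_zero]
  ring

lemma deriv_thetaProd_ne_zero (hT : 0 < T.im) {u : ℂ} (hu : thetaProd T u = 0) :
    deriv (thetaProd T) u ≠ 0 := by
  obtain ⟨m, n, rfl⟩ := (thetaProd_eq_zero_iff hT u).1 hu
  clear hu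
  have hd := differentiable_thetaProd hT
  have key := lattice_induction (T := T)
    (P := fun u => thetaProd T u = 0 ∧ deriv (thetaProd T) u ≠ 0) ?_ (fun u => ?_)
      (fun u => ?_) m n
  · exact key.2
  · refine ⟨(thetaProd_eq_zero_iff hT 0).2 ⟨0, 0, by simp⟩, ?_⟩
    rw [(hasDerivAt_thetaProd_zero hT).deriv]
    have := qPochInf_ne_zero_of_norm_lt (norm_ex_lt_one hT) (norm_ex_lt_one hT)
    simpa [Real.pi_ne_zero] using this
  · have : deriv (thetaProd T) (u + 1) = deriv (thetaProd T) u := by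
      rw [← deriv_comp_add_const]
      simp only [thetaProd_add_one]
    rw [this, thetaProd_add_one]
  · rw [thetaProd_add hT]
    have h0 : -(ex u)⁻¹ ≠ 0 := neg_ne_zero.2 (inv_ne_zero (ex_ne_zero u))
    rw [mul_eq_zero, or_iff_right h0]
    refine and_congr_right fun h => ?_
    have hi : DifferentiableAt ℂ (fun u => -(ex u)⁻¹) u :=
      ((differentiable_ex u).inv (ex_ne_zero u)).neg
    have : deriv (thetaProd T) (u + T) = -(ex u)⁻¹ * deriv (thetaProd T) u := by
      rw [← deriv_comp_add_const]
      have e : (fun x => thetaProd T (x + T)) = fun x => -(ex x)⁻¹ * thetaProd T x :=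
        funext fun x => thetaProd_add hT x
      rw [e]
      have := (hi.hasDerivAt.mul (hd u).hasDerivAt).deriv
      rw [h, mul_zero, zero_add] at this
      exact this
    rw [this, Ne, mul_eq_zero, or_iff_right h0]

lemma exists_eq_mul_thetaProd (hT : 0 < T.im) {X : ℂ → ℂ} (hX : Differentiable ℂ X)
    (h : ∀ m n : ℤ, X (m * T + n) = 0) :
    ∃ g : ℂ → ℂ, Differentiable ℂ g ∧ ∀ u, X u = g u * thetaProd T u :=
  exists_entire_quotient hX (differentiable_thetaProd hT) fun a ha => by
    refine ⟨?_, deriv_thetaProd_ne_zero hT ha⟩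
    obtain ⟨m, n, rfl⟩ := (thetaProd_eq_zero_iff hT a).1 ha
    exact h m n

end Theta

section FourierSeries

/-- Gaussian decay of a doubly infinite sequence of coefficients. -/
def GaussDecay (a : ℤ → ℂ) : Prop :=
  ∃ C c : ℝ, 0 < c ∧ ∀ n, ‖a n‖ ≤ C * Real.exp (-(c * n ^ 2))

/-- Holomorphy together with locally uniform Gaussian decay of coefficient functions near `τ`. -/
def GaussDecayAt (a : ℤ → ℂ → ℂ) (τ : ℂ) : Prop :=
  ∃ r C c : ℝ, 0 < r ∧ 0 < c ∧ ∀ n, DifferentiableOn ℂ (a n) (Metric.ball τ r) ∧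
    ∀ t ∈ Metric.ball τ r, ‖a n t‖ ≤ C * Real.exp (-(c * n ^ 2))

/-- The Fourier series `∑ aₙ e^{2πinu}`. -/
def fSeries (a : ℤ → ℂ) (u : ℂ) : ℂ := ∑' n : ℤ, a n * ex (n * u)

lemma summable_gauss {c : ℝ} (hc : 0 < c) (K : ℝ) :
    Summable fun n : ℤ => Real.exp (-(c * n ^ 2)) * Real.exp (K * |(n : ℝ)|) := by
  have h := summable_pow_mul_jacobiTheta₂_term_bound (K / (2 * π)) (div_pos hc Real.pi_pos) 0
  refine h.congr fun n => ?_
  rw [pow_zero, one_mul, ← Real.exp_add]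
  congr 1
  push_cast
  field_simp [Real.pi_ne_zero]
  ring

lemma norm_ex_int_mul_le {R : ℝ} {u : ℂ} (hu : |u.im| ≤ R) (n : ℤ) :
    ‖ex (n * u)‖ ≤ Real.exp (2 * π * R * |(n : ℝ)|) := by
  rw [norm_ex, Real.exp_le_exp]
  have h1 : (n * u : ℂ).im = n * u.im := by simp
  have h2 : -((n : ℝ) * u.im) ≤ |(n : ℝ)| * R :=
    (neg_le_abs _).trans (by rw [abs_mul]; gcongr)
  rw [h1]
  nlinarith [Real.pi_pos]

lemma norm_term_le {C c R : ℝ} {x u : ℂ} {n : ℤ} (hx : ‖x‖ ≤ C * Real.exp (-(c * n ^ 2)))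
    (hu : |u.im| ≤ R) : ‖x * ex (n * u)‖ ≤
      C * (Real.exp (-(c * n ^ 2)) * Real.exp (2 * π * R * |(n : ℝ)|)) := by
  rw [norm_mul, ← mul_assoc]
  exact mul_le_mul hx (norm_ex_int_mul_le hu n) (norm_nonneg _) ((norm_nonneg _).trans hx)

variable {a b d : ℤ → ℂ}

lemma GaussDecay.summable (ha : GaussDecay a) (u : ℂ) :
    Summable fun n : ℤ => a n * ex (n * u) := by
  obtain ⟨C, c, hc, h⟩ := ha
  exact ((summable_gauss hc _).mul_left C).of_norm_bounded fun n => norm_term_le (h n) le_rfl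

lemma GaussDecay.add (ha : GaussDecay a) (hb : GaussDecay b) :
    GaussDecay fun n => a n + b n := by
  obtain ⟨C, c, hc, h⟩ := ha
  obtain ⟨C', c', hc', h'⟩ := hb
  have hC : 0 ≤ C := by simpa using (norm_nonneg _).trans (h 0)
  have hC' : 0 ≤ C' := by simpa using (norm_nonneg _).trans (h' 0)
  refine ⟨C + C', min c c', lt_min hc hc', fun n => ?_⟩
  rw [add_mul]
  refine norm_add_le_of_le ((h n).trans ?_) ((h' n).trans ?_)
  · gcongr; exact min_le_left _ _
  · gcongr; exact min_le_right _ _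

lemma GaussDecay.const_mul (ha : GaussDecay a) (k : ℂ) : GaussDecay fun n => k * a n := by
  obtain ⟨C, c, hc, h⟩ := ha
  refine ⟨‖k‖ * C, c, hc, fun n => ?_⟩
  rw [norm_mul, mul_assoc]
  gcongr
  exact h n

lemma GaussDecay.sub (ha : GaussDecay a) (hb : GaussDecay b) :
    GaussDecay fun n => a n - b n := by
  simpa [sub_eq_add_neg] using ha.add (hb.const_mul (-1))

lemma GaussDecay.int_mul (ha : GaussDecay a) : GaussDecay fun n => n * a n := by
  obtain ⟨C, c, hc, h⟩ := ha
  have hC : 0 ≤ C := by simpa using (norm_nonneg _).trans (h 0)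
  refine ⟨C * (2 / c), c / 2, half_pos hc, fun n => ?_⟩
  have h1 : |(n : ℝ)| ≤ (n : ℝ) ^ 2 := by
    rw [← sq_abs]
    rcases eq_or_ne n 0 with rfl | hn
    · simp
    · have : (1 : ℝ) ≤ |(n : ℝ)| := by exact_mod_cast Int.one_le_abs hn
      nlinarith
  have h2 : (n : ℝ) ^ 2 ≤ 2 / c * Real.exp (c / 2 * n ^ 2) := by
    have := Real.add_one_le_exp (c / 2 * (n : ℝ) ^ 2)
    calc (n : ℝ) ^ 2 = 2 / c * (c / 2 * n ^ 2) := by field_simp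
      _ ≤ _ := by gcongr; linarith
  have e : Real.exp (-(c * n ^ 2)) = Real.exp (-(c / 2 * n ^ 2)) * Real.exp (-(c / 2 * n ^ 2)) := by
    rw [← Real.exp_add]; congr 1; ring
  have e' : Real.exp (c / 2 * n ^ 2) * Real.exp (-(c / 2 * n ^ 2)) = 1 := by
    rw [← Real.exp_add]; simp
  rw [norm_mul, Complex.norm_intCast]
  calc |(n : ℝ)| * ‖a n‖ ≤ (2 / c * Real.exp (c / 2 * n ^ 2)) * (C * Real.exp (-(c * n ^ 2))) := by
        gcongr
        · exact h1.trans h2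
        · exact h n
    _ = C * (2 / c) * (Real.exp (c / 2 * n ^ 2) * Real.exp (-(c / 2 * n ^ 2))) *
        Real.exp (-(c / 2 * n ^ 2)) := by rw [e]; ring
    _ = _ := by rw [e', mul_one]

lemma isOpen_abs_im_lt (R : ℝ) : IsOpen {u : ℂ | |u.im| < R} :=
  isOpen_lt (Complex.continuous_im.abs) continuous_const

lemma differentiable_ex_int_mul (n : ℤ) : Differentiable ℂ fun u => ex (n * u) :=
  differentiable_ex.comp (differentiable_id.const_mul _)

lemma hasDerivAt_ex_mul (k u : ℂ) :
    HasDerivAt (fun u => ex (k * u)) (2 * π * I * (k * ex (k * u))) u := by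
  have := (hasDerivAt_ex (k * u)).comp u ((hasDerivAt_id u).const_mul k)
  exact this.congr_deriv (by simp; ring)

lemma GaussDecay.hasDerivAt (ha : GaussDecay a) (u : ℂ) :
    HasDerivAt (fSeries a) (2 * π * I * fSeries (fun n => n * a n) u) u := by
  obtain ⟨C, c, hc, h⟩ := id ha
  have hsum := (summable_gauss hc (2 * π * (|u.im| + 1))).mul_left C
  have hd : ∀ n : ℤ, DifferentiableOn ℂ (fun u => a n * ex (n * u))
      {w : ℂ | |w.im| < |u.im| + 1} := fun n =>
    ((differentiable_ex_int_mul n).const_mul _).differentiableOn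
  have hb : ∀ (n : ℤ) (w : ℂ), w ∈ {w : ℂ | |w.im| < |u.im| + 1} → ‖a n * ex (n * w)‖ ≤ _ :=
    fun n w hw => norm_term_le (h n) (le_of_lt hw)
  have ho := isOpen_abs_im_lt (|u.im| + 1)
  have hu : u ∈ {w : ℂ | |w.im| < |u.im| + 1} := lt_add_one |u.im|
  have hD := (differentiableOn_tsum_of_summable_norm hsum hd ho hb).differentiableAt (ho.mem_nhds hu)
  have hS := hasSum_deriv_of_summable_norm hsum hd ho hb hu
  refine hD.hasDerivAt.congr_deriv ?_
  rw [← hS.tsum_eq, fSeries, ← tsum_mul_left]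
  refine tsum_congr fun n => ?_
  rw [((hasDerivAt_ex_mul n u).const_mul (a n)).deriv]
  ring

lemma GaussDecay.differentiable (ha : GaussDecay a) : Differentiable ℂ (fSeries a) :=
  fun u => (ha.hasDerivAt u).differentiableAt

lemma fSeries_add (ha : GaussDecay a) (hb : GaussDecay b) (u : ℂ) :
    fSeries (fun n => a n + b n) u = fSeries a u + fSeries b u := by
  simp only [fSeries, add_mul]
  exact (ha.summable u).tsum_add (hb.summable u)

lemma fSeries_const_mul (a : ℤ → ℂ) (k u : ℂ) :
    fSeries (fun n => k * a n) u = k * fSeries a u := by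
  simp only [fSeries, mul_assoc]
  exact tsum_mul_left

lemma fSeries_sub (ha : GaussDecay a) (hb : GaussDecay b) (u : ℂ) :
    fSeries (fun n => a n - b n) u = fSeries a u - fSeries b u := by
  simp only [fSeries, sub_mul]
  exact (ha.summable u).tsum_sub (hb.summable u)

lemma fSeries_add_one (a : ℤ → ℂ) (u : ℂ) : fSeries a (u + 1) = fSeries a u := by
  refine tsum_congr fun n => ?_
  rw [mul_add, ex_add, mul_one, ex_int, mul_one]

lemma fSeries_succ (d : ℤ → ℂ) (u : ℂ) :
    ∑' n : ℤ, d (n + 1) * ex (n * u) = (ex u)⁻¹ * fSeries d u := by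
  rw [fSeries, ← tsum_mul_left,
    ← (Equiv.addRight (1 : ℤ)).tsum_eq fun n => (ex u)⁻¹ * (d n * ex (n * u))]
  refine tsum_congr fun n => ?_
  have := ex_ne_zero u
  simp only [Equiv.coe_addRight]
  push_cast
  rw [add_mul, ex_add, one_mul]
  field_simp

lemma summable_succ (hd : GaussDecay d) (u : ℂ) :
    Summable fun n : ℤ => d (n + 1) * ex (n * u) := by
  have h := ((Equiv.addRight (1 : ℤ)).summable_iff.2 (hd.summable u)).mul_left (ex u)⁻¹
  refine h.congr fun n => ?_
  have := ex_ne_zero u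
  simp only [Equiv.coe_addRight, Function.comp]
  push_cast
  rw [add_mul, ex_add, one_mul]
  field_simp

/-- Effect of the shift `u ↦ u + T` on Fourier series. -/
lemma fSeries_add_period {T : ℂ} (hb : GaussDecay b) (hd : GaussDecay d)
    (h : ∀ n : ℤ, a n * ex (n * T) = b n - d (n + 1)) (u : ℂ) :
    fSeries a (u + T) = fSeries b u - (ex u)⁻¹ * fSeries d u := by
  rw [← fSeries_succ, fSeries, fSeries, ← (hb.summable u).tsum_sub (summable_succ hd u)]
  refine tsum_congr fun n => ?_
  rw [mul_add, ex_add, ← sub_mul, ← h]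
  ring

/-- Effect of the reflection `u ↦ -u` on Fourier series. -/
lemma fSeries_neg (h : ∀ n : ℤ, a (-n) = -d (n + 1)) (u : ℂ) :
    fSeries a (-u) = -((ex u)⁻¹ * fSeries d u) := by
  rw [← fSeries_succ, ← tsum_neg, fSeries, ← (Equiv.neg ℤ).tsum_eq]
  refine tsum_congr fun n => ?_
  simp only [Equiv.neg_apply]
  rw [h]
  push_cast
  rw [neg_mul_neg, neg_mul]

lemma GaussDecayAt.self {a : ℤ → ℂ → ℂ} {τ : ℂ} (ha : GaussDecayAt a τ) :
    GaussDecay fun n => a n τ := by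
  obtain ⟨r, C, c, hr, hc, h⟩ := ha
  exact ⟨C, c, hc, fun n => (h n).2 τ (Metric.mem_ball_self hr)⟩

lemma GaussDecayAt.deriv {a : ℤ → ℂ → ℂ} {τ : ℂ} (ha : GaussDecayAt a τ) :
    GaussDecay fun n => deriv (a n) τ := by
  obtain ⟨r, C, c, hr, hc, h⟩ := ha
  refine ⟨C / (r / 2), c, hc, fun n => ?_⟩
  have hsub : Metric.closedBall τ (r / 2) ⊆ Metric.ball τ r :=
    Metric.closedBall_subset_ball (half_lt_self hr)
  have h1 := norm_deriv_le_of_forall_mem_sphere_norm_le (half_pos hr)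
    ((h n).1.diffContOnCl_ball hsub)
    (fun t ht => (h n).2 t (hsub (Metric.sphere_subset_closedBall ht)))
  exact h1.trans (le_of_eq (by ring))

lemma GaussDecayAt.hasDerivAt {a : ℤ → ℂ → ℂ} {τ : ℂ} (ha : GaussDecayAt a τ) (u : ℂ) :
    HasDerivAt (fun t => fSeries (fun n => a n t) u)
      (fSeries (fun n => _root_.deriv (a n) τ) u) τ := by
  obtain ⟨r, C, c, hr, hc, h⟩ := ha
  have hsum := (summable_gauss hc (2 * π * |u.im|)).mul_left C
  have hd : ∀ n : ℤ, DifferentiableOn ℂ (fun t => a n t * ex (n * u)) (Metric.ball τ r) :=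
    fun n => (h n).1.mul_const _
  have hb : ∀ (n : ℤ) (w : ℂ), w ∈ Metric.ball τ r → ‖a n w * ex (n * u)‖ ≤ _ :=
    fun n w hw => norm_term_le ((h n).2 w hw) le_rfl
  have hm := Metric.mem_ball_self (x := τ) hr
  have hD := (differentiableOn_tsum_of_summable_norm hsum hd Metric.isOpen_ball hb).differentiableAt
    (Metric.isOpen_ball.mem_nhds hm)
  have hS := hasSum_deriv_of_summable_norm hsum hd Metric.isOpen_ball hb hm
  refine hD.hasDerivAt.congr_deriv ?_
  rw [← hS.tsum_eq, fSeries]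
  refine tsum_congr fun n => ?_
  exact deriv_mul_const (((h n).1 τ hm).differentiableAt (Metric.isOpen_ball.mem_nhds hm)) _

lemma integral_ex_int_mul (n : ℤ) :
    ∫ x in (0 : ℝ)..1, ex (n * x) = if n = 0 then 1 else 0 := by
  split_ifs with hn
  · simp [hn, ex_zero]
  · have hc : (2 * π * I * n : ℂ) ≠ 0 := mul_ne_zero Complex.two_pi_I_ne_zero (by exact_mod_cast hn)
    have := integral_exp_mul_complex (a := 0) (b := 1) hc
    simp only [ex, ← mul_assoc]
    rw [this]
    have h1 : Complex.exp (2 * π * I * n) = 1 := ex_int n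
    simp [h1]

/-- The zeroth Fourier coefficient of a vanishing series is zero. -/
lemma GaussDecay.coeff_zero (ha : GaussDecay a) (h0 : ∀ u, fSeries a u = 0) : a 0 = 0 := by
  obtain ⟨C, c, hc, h⟩ := id ha
  have hsum := (summable_gauss hc 0).mul_left C
  have key := intervalIntegral.hasSum_integral_of_dominated_convergence (a := 0) (b := 1)
    (μ := MeasureTheory.volume) (F := fun (n : ℤ) (x : ℝ) => a n * ex (n * x)) (f := fun _ => 0)
    (fun n _ => C * (Real.exp (-(c * n ^ 2)) * Real.exp (0 * |(n : ℝ)|)))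
    (fun n => ((continuous_const.mul ((differentiable_ex_int_mul n).continuous.comp
      Complex.continuous_ofReal)).aestronglyMeasurable))
    (fun n => Eventually.of_forall fun x _ => by
      have := norm_term_le (R := 0) (u := (x : ℂ)) (h n) (by simp)
      simpa using this)
    (Eventually.of_forall fun x _ => hsum) (by simp)
    (Eventually.of_forall fun x _ => by
      have := (ha.summable (x : ℂ)).hasSum
      rwa [show ∑' n : ℤ, a n * ex (n * x) = 0 from h0 x] at this)
  simp only [intervalIntegral.integral_const_mul, integral_ex_int_mul,
    intervalIntegral.integral_zero] at key
  have k2 := hasSum_single (f := fun n : ℤ => a n * if n = 0 then (1 : ℂ) else 0) 0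
    (fun n hn => by simp [hn])
  simpa using k2.unique key

end FourierSeries

section Coefficients

/-- Coefficients of the theta series `∑ (-1)ⁿ q^{n²-n} zⁿ`. -/
def jCoeff (n : ℤ) (t : ℂ) : ℂ := (-1) ^ n * ex ((n ^ 2 - n) * t)

/-- Coefficients of the companion false-theta-like series solving an inhomogeneous
functional equation. -/
def bCoeff (n : ℤ) (t : ℂ) : ℂ :=
  -((-1) ^ n * ex ((n ^ 2 + n - 1) * t) / (1 - ex ((2 * n - 1) * t)))

lemma one_sub_ex_ne_zero {k : ℤ} (hk : k ≠ 0) {t : ℂ} (ht : 0 < t.im) : 1 - ex (k * t) ≠ 0 := by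
  intro h
  obtain ⟨n, hn⟩ := (ex_eq_one_iff _).1 (sub_eq_zero.1 h).symm
  have := congrArg Complex.im hn
  simp [hk, ht.ne'] at this

lemma one_sub_ex_odd_ne_zero (n : ℤ) {t : ℂ} (ht : 0 < t.im) :
    1 - ex ((2 * n - 1) * t) ≠ 0 := by
  have := one_sub_ex_ne_zero (k := 2 * n - 1) (by lia) ht
  push_cast at this
  exact this

lemma jCoeff_shift (n : ℤ) (t : ℂ) : jCoeff n t * ex (n * (2 * t)) = -jCoeff (n + 1) t := by
  have e : ex (((n : ℂ) + 1) ^ 2 * t - (n + 1) * t) = ex ((n ^ 2 - n) * t) * ex (n * (2 * t)) := by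
    rw [← ex_add]; congr 1; ring
  simp only [jCoeff]
  rw [zpow_add_one₀ (by norm_num)]
  push_cast
  rw [sub_mul (((n : ℂ) + 1) ^ 2), e]
  ring

lemma jCoeff_neg (n : ℤ) (t : ℂ) : jCoeff (-n) t = -jCoeff (n + 1) t := by
  simp only [jCoeff]
  rw [zpow_add_one₀ (by norm_num), zpow_neg, ← inv_zpow, inv_neg_one]
  push_cast
  rw [show ((-(n : ℂ)) ^ 2 - -(n : ℂ)) = ((n + 1) ^ 2 - (n + 1)) by ring]
  ring

lemma bCoeff_shift (n : ℤ) {t : ℂ} (ht : 0 < t.im) :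
    bCoeff n t * ex (n * (2 * t)) = ex t * bCoeff n t - jCoeff (n + 1) t := by
  have h := one_sub_ex_odd_ne_zero n ht
  have e1 : ex (n * (2 * t)) = ex t * ex ((2 * n - 1) * t) := by
    rw [← ex_add]; congr 1; ring
  have e2 : ex ((((n : ℂ) + 1) ^ 2 - (n + 1)) * t) = ex t * ex ((n ^ 2 + n - 1) * t) := by
    rw [← ex_add]; congr 1; ring
  simp only [jCoeff, bCoeff]
  rw [zpow_add_one₀ (by norm_num)]
  push_cast
  rw [e1, e2]
  generalize ex ((2 * n - 1) * t) = v at *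
  field_simp
  ring

lemma bCoeff_neg (n : ℤ) {t : ℂ} (ht : 0 < t.im) :
    bCoeff (-n) t = -(jCoeff (n + 1) t - bCoeff (n + 1) t) := by
  have h := one_sub_ex_odd_ne_zero (-n) ht
  have h' := one_sub_ex_odd_ne_zero (n + 1) ht
  have e1 : ex ((2 * ((-n : ℤ) : ℂ) - 1) * t) = (ex ((2 * ((n + 1 : ℤ) : ℂ) - 1) * t))⁻¹ := by
    rw [← ex_neg]; congr 1; push_cast; ring
  have e2 : ex ((((n + 1 : ℤ) : ℂ) ^ 2 + ((n + 1 : ℤ) : ℂ) - 1) * t) =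
      ex ((((n + 1 : ℤ) : ℂ) ^ 2 - ((n + 1 : ℤ) : ℂ)) * t) * ex ((2 * ((n + 1 : ℤ) : ℂ) - 1) * t) := by
    rw [← ex_add]; congr 1; ring
  have e3 : ex ((((n + 1 : ℤ) : ℂ) ^ 2 - ((n + 1 : ℤ) : ℂ)) * t) =
      ex ((((-n : ℤ) : ℂ) ^ 2 + ((-n : ℤ) : ℂ) - 1) * t) * ex ((2 * ((n + 1 : ℤ) : ℂ) - 1) * t) := by
    rw [← ex_add]; congr 1; push_cast; ring
  have hy := ex_ne_zero ((2 * ((n + 1 : ℤ) : ℂ) - 1) * t)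
  simp only [jCoeff, bCoeff]
  rw [e1] at h ⊢
  rw [e2, e3, zpow_add_one₀ (by norm_num), zpow_neg, ← inv_zpow, inv_neg_one]
  generalize ex ((2 * ((n + 1 : ℤ) : ℂ) - 1) * t) = y at *
  have h2 : y - 1 ≠ 0 := fun h0 => h' (by linear_combination -h0)
  have h3 : 1 - y⁻¹ = (y - 1) / y := by field_simp
  rw [h3]
  field_simp
  ring

lemma differentiable_jCoeff (n : ℤ) : Differentiable ℂ (jCoeff n) := fun t =>
  ((hasDerivAt_ex_mul _ t).differentiableAt).const_mul _

lemma differentiableAt_bCoeff (n : ℤ) {t : ℂ} (ht : 0 < t.im) :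
    DifferentiableAt ℂ (bCoeff n) t :=
  (((hasDerivAt_ex_mul _ t).differentiableAt.const_mul _).div
    ((hasDerivAt_ex_mul _ t).differentiableAt.const_sub 1) (one_sub_ex_odd_ne_zero n ht)).neg

lemma norm_neg_one_zpow (n : ℤ) : ‖(-1 : ℂ) ^ n‖ = 1 := by simp

lemma norm_ex_int_mul (k : ℤ) (t : ℂ) : ‖ex (k * t)‖ = Real.exp (-(2 * π * (k * t.im))) := by
  rw [norm_ex]; simp

variable {τ : ℂ}

lemma half_lt_im_of_mem_ball {t : ℂ} (ht : t ∈ Metric.ball τ (τ.im / 2)) : τ.im / 2 < t.im := by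
  have h1 := (Complex.abs_im_le_norm (t - τ)).trans_lt (mem_ball_iff_norm.1 ht)
  rw [Complex.sub_im, abs_lt] at h1
  linarith [h1.1]

lemma norm_jCoeff_le (n : ℤ) {t : ℂ} {y : ℝ} (hy : 0 < y) (ht : y < t.im) :
    ‖jCoeff n t‖ ≤ Real.exp (π * y) * Real.exp (-(π * y * n ^ 2)) := by
  have e : ((n : ℂ) ^ 2 - n) = ((n ^ 2 - n : ℤ) : ℂ) := by push_cast; rfl
  rw [jCoeff, norm_mul, norm_neg_one_zpow, one_mul, e, norm_ex_int_mul, ← Real.exp_add,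
    Real.exp_le_exp]
  push_cast
  have h0 : (0 : ℝ) ≤ (n : ℝ) ^ 2 - n := by
    have : (0 : ℤ) ≤ n ^ 2 - n := by nlinarith [Int.le_self_sq n]
    exact_mod_cast this
  have h1 : ((n : ℝ) ^ 2 - n) * y ≤ (n ^ 2 - n) * t.im := by gcongr
  have h2 : 0 ≤ y * ((n : ℝ) - 1) ^ 2 := by positivity
  nlinarith [Real.pi_pos]

lemma norm_bCoeff_le (n : ℤ) {t : ℂ} {y : ℝ} (hy : 0 < y) (ht : y < t.im) :
    ‖bCoeff n t‖ ≤ (1 - Real.exp (-(2 * π * y)))⁻¹ * Real.exp (-(2 * π * y * n ^ 2)) := by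
  have hpi := Real.pi_pos
  have ht0 : 0 < t.im := hy.trans ht
  have hpos : 0 < 1 - Real.exp (-(2 * π * y)) := by
    rw [sub_pos, Real.exp_lt_one_iff]; nlinarith [mul_pos hpi hy]
  have main : ∀ (m k : ℤ), n ^ 2 ≤ m → 1 ≤ k →
      ‖ex (m * t) / (1 - ex (k * t))‖ ≤
        (1 - Real.exp (-(2 * π * y)))⁻¹ * Real.exp (-(2 * π * y * n ^ 2)) := by
    intro m k hm hk
    have hm' : (n : ℝ) ^ 2 ≤ m := by exact_mod_cast hm
    have hk' : (1 : ℝ) ≤ k := by exact_mod_cast hk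
    have hm0 : (0 : ℝ) ≤ m := (sq_nonneg _).trans hm'
    have h1 : ‖ex (m * t)‖ ≤ Real.exp (-(2 * π * y * n ^ 2)) := by
      rw [norm_ex_int_mul, Real.exp_le_exp]
      have : (n : ℝ) ^ 2 * y ≤ m * t.im := by gcongr
      nlinarith
    have h2 : 1 - Real.exp (-(2 * π * y)) ≤ ‖1 - ex (k * t)‖ := by
      have h3 := norm_sub_norm_le (1 : ℂ) (ex (k * t))
      rw [norm_one, norm_ex_int_mul] at h3
      refine le_trans ?_ h3
      gcongr
      nlinarith
    rw [norm_div, div_eq_inv_mul]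
    gcongr
  rw [bCoeff, norm_neg, mul_div_assoc, norm_mul, norm_neg_one_zpow, one_mul]
  rcases le_or_gt 1 n with hn | hn
  · have := main (n ^ 2 + n - 1) (2 * n - 1) (by linarith) (by linarith)
    push_cast at this
    exact this
  · have := main (n ^ 2 - n) (1 - 2 * n) (by linarith) (by lia)
    push_cast at this
    refine le_trans (le_of_eq ?_) this
    have hne := one_sub_ex_odd_ne_zero n ht0
    have e1 : ex ((1 - 2 * n) * t) = (ex ((2 * n - 1) * t))⁻¹ := by
      rw [← ex_neg]; congr 1; ring
    have e2 : ex ((n ^ 2 + n - 1) * t) = ex ((n ^ 2 - n) * t) * ex ((2 * n - 1) * t) := by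
      rw [← ex_add]; congr 1; ring
    have hy0 := ex_ne_zero ((2 * n - 1) * t)
    rw [e1, e2]
    generalize ex ((2 * n - 1) * t) = v at *
    have h2 : v - 1 ≠ 0 := fun h0 => hne (by linear_combination -h0)
    have h3 : 1 - v⁻¹ = -((1 - v) / v) := by field_simp; ring
    rw [h3, div_neg, norm_neg, div_div_eq_mul_div]

lemma gaussDecayAt_jCoeff (hτ : 0 < τ.im) : GaussDecayAt jCoeff τ :=
  ⟨τ.im / 2, Real.exp (π * (τ.im / 2)), π * (τ.im / 2), half_pos hτ, by positivity, fun n =>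
    ⟨(differentiable_jCoeff n).differentiableOn, fun _ ht =>
      norm_jCoeff_le n (half_pos hτ) (half_lt_im_of_mem_ball ht)⟩⟩

lemma gaussDecayAt_bCoeff (hτ : 0 < τ.im) : GaussDecayAt bCoeff τ :=
  ⟨τ.im / 2, _, 2 * π * (τ.im / 2), half_pos hτ, by positivity, fun n =>
    ⟨fun _ ht => (differentiableAt_bCoeff n ((half_pos hτ).trans
      (half_lt_im_of_mem_ball ht))).differentiableWithinAt, fun _ ht =>
      norm_bCoeff_le n (half_pos hτ) (half_lt_im_of_mem_ball ht)⟩⟩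

/-- The normalised derivative `(2πi)⁻¹ d/dτ` of coefficient functions. -/
def coeffDeriv (a : ℤ → ℂ → ℂ) (τ : ℂ) (n : ℤ) : ℂ := (2 * π * I)⁻¹ * deriv (a n) τ

lemma hasDerivAt_jCoeff (n : ℤ) (τ : ℂ) :
    HasDerivAt (jCoeff n) (2 * π * I * coeffDeriv jCoeff τ n) τ :=
  (differentiable_jCoeff n τ).hasDerivAt.congr_deriv
    (by rw [coeffDeriv, mul_inv_cancel_left₀ Complex.two_pi_I_ne_zero])

lemma hasDerivAt_bCoeff (hτ : 0 < τ.im) (n : ℤ) :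
    HasDerivAt (bCoeff n) (2 * π * I * coeffDeriv bCoeff τ n) τ :=
  (differentiableAt_bCoeff n hτ).hasDerivAt.congr_deriv
    (by rw [coeffDeriv, mul_inv_cancel_left₀ Complex.two_pi_I_ne_zero])

lemma coeffDeriv_jCoeff_shift (n : ℤ) (τ : ℂ) :
    (coeffDeriv jCoeff τ n + 2 * (n * jCoeff n τ)) * ex (n * (2 * τ)) =
      -coeffDeriv jCoeff τ (n + 1) := by
  have h := (hasDerivAt_jCoeff n τ).mul (hasDerivAt_ex_mul (n * 2) τ)
  have h' := (hasDerivAt_jCoeff (n + 1) τ).neg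
  have e : (jCoeff n * fun t => ex (n * 2 * t)) = -jCoeff (n + 1) := funext fun t => by
    have := jCoeff_shift n t
    rw [← mul_assoc] at this
    exact this
  rw [e] at h
  have := h.unique h'
  refine mul_left_cancel₀ Complex.two_pi_I_ne_zero ?_
  rw [← mul_assoc (n : ℂ) 2 τ]
  linear_combination this

lemma coeffDeriv_jCoeff_neg (n : ℤ) (τ : ℂ) :
    coeffDeriv jCoeff τ (-n) = -coeffDeriv jCoeff τ (n + 1) := by
  have h := hasDerivAt_jCoeff (-n) τ
  have h' := (hasDerivAt_jCoeff (n + 1) τ).neg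
  rw [show jCoeff (-n) = -jCoeff (n + 1) from funext fun t => jCoeff_neg n t] at h
  have := h.unique h'
  refine mul_left_cancel₀ Complex.two_pi_I_ne_zero ?_
  linear_combination this

lemma eventually_im_pos (hτ : 0 < τ.im) : ∀ᶠ t : ℂ in nhds τ, 0 < t.im :=
  (isOpen_lt continuous_const Complex.continuous_im).mem_nhds hτ

lemma coeffDeriv_bCoeff_shift (hτ : 0 < τ.im) (n : ℤ) :
    (coeffDeriv bCoeff τ n + 2 * (n * bCoeff n τ)) * ex (n * (2 * τ)) =
      ex τ * (bCoeff n τ + coeffDeriv bCoeff τ n) - coeffDeriv jCoeff τ (n + 1) := by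
  have h := (hasDerivAt_bCoeff hτ n).mul (hasDerivAt_ex_mul (n * 2) τ)
  have h' := ((hasDerivAt_ex τ).mul (hasDerivAt_bCoeff hτ n)).sub (hasDerivAt_jCoeff (n + 1) τ)
  have := h.unique (h'.congr_of_eventuallyEq (by
    filter_upwards [eventually_im_pos hτ] with t ht
    have := bCoeff_shift n ht
    rw [← mul_assoc] at this
    exact this))
  refine mul_left_cancel₀ Complex.two_pi_I_ne_zero ?_
  rw [← mul_assoc (n : ℂ) 2 τ]
  linear_combination this

lemma coeffDeriv_bCoeff_neg (hτ : 0 < τ.im) (n : ℤ) :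
    coeffDeriv bCoeff τ (-n) = -(coeffDeriv jCoeff τ (n + 1) - coeffDeriv bCoeff τ (n + 1)) := by
  have h := hasDerivAt_bCoeff hτ (-n)
  have h' := ((hasDerivAt_jCoeff (n + 1) τ).sub (hasDerivAt_bCoeff hτ (n + 1))).neg
  have := h.unique (h'.congr_of_eventuallyEq (by
    filter_upwards [eventually_im_pos hτ] with t ht
    exact bCoeff_neg n ht))
  refine mul_left_cancel₀ Complex.two_pi_I_ne_zero ?_
  linear_combination this

end Coefficients

section Wronskian

lemma eq_zero_of_mul_thetaProd {T : ℂ} (hT : 0 < T.im) {f : ℂ → ℂ} (hf : Differentiable ℂ f)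
    (h : ∀ u, f u * thetaProd T u = 0) (u : ℂ) : f u = 0 := by
  by_cases hu : thetaProd T u = 0
  · have h1 := (hf u).hasDerivAt.mul (differentiable_thetaProd hT u).hasDerivAt
    rw [show f * thetaProd T = fun _ => 0 from funext h, hu, mul_zero, zero_add] at h1
    exact (mul_eq_zero.1 (h1.unique (hasDerivAt_const u 0))).resolve_right
      (deriv_thetaProd_ne_zero hT hu)
  · exact (mul_eq_zero.1 (h u)).resolve_right hu

/-- An entire function with the zeros and the quasi-periodicity of `w · thetaProd T` is a constant
multiple of it. -/
lemma exists_eq_const_mul_thetaProd {T T' : ℂ} (hT : 0 < T.im) (hT' : 0 < T'.im)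
    {X w c₁ c₂ : ℂ → ℂ} (hX : Differentiable ℂ X) (hw : Differentiable ℂ w) (hw0 : ∀ u, w u ≠ 0)
    (h0 : ∀ m n : ℤ, X (m * T + n) = 0) (hc₁ : ∀ u, c₁ u ≠ 0) (hc₂ : ∀ u, c₂ u ≠ 0)
    (hX₁ : ∀ u, X (u + 1) = c₁ u * X u) (hX₂ : ∀ u, X (u + T') = c₂ u * X u)
    (hY₁ : ∀ u, w (u + 1) * thetaProd T (u + 1) = c₁ u * (w u * thetaProd T u))
    (hY₂ : ∀ u, w (u + T') * thetaProd T (u + T') = c₂ u * (w u * thetaProd T u)) :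
    ∃ c, ∀ u, X u = c * (w u * thetaProd T u) := by
  obtain ⟨g, hg, hgX⟩ := exists_eq_mul_thetaProd hT hX h0
  have hG : Differentiable ℂ fun u => g u / w u := hg.div hw hw0
  have hGX : ∀ u, X u = g u / w u * (w u * thetaProd T u) := fun u => by
    rw [hgX, ← mul_assoc, div_mul_cancel₀ _ (hw0 u)]
  have per : ∀ (s : ℂ) (c : ℂ → ℂ), (∀ u, c u ≠ 0) → (∀ u, X (u + s) = c u * X u) →
      (∀ u, w (u + s) * thetaProd T (u + s) = c u * (w u * thetaProd T u)) →
      ∀ u, g (u + s) / w (u + s) = g u / w u := by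
    intro s c hc h1 h2 u
    refine sub_eq_zero.1 (eq_zero_of_mul_thetaProd hT
      (f := fun u => g (u + s) / w (u + s) - g u / w u)
      ((hG.comp (differentiable_id.add_const s)).sub hG) (fun u => ?_) u)
    have h3 := h1 u
    rw [hGX (u + s), hGX u, h2 u] at h3
    refine mul_left_cancel₀ (mul_ne_zero (hc u) (hw0 u)) ?_
    linear_combination h3
  refine ⟨g 0 / w 0, fun u => ?_⟩
  rw [hGX u, eq_const_of_periodic hT' hG (per 1 c₁ hc₁ hX₁ hY₁) (per T' c₂ hc₂ hX₂ hY₂) u]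

/-- The `k`-th derivative (with respect to `δ_z`) of the theta series. -/
def jS (k : ℕ) (τ u : ℂ) : ℂ := fSeries (fun n => n ^ k * jCoeff n τ) u

/-- The `k`-th derivative (with respect to `δ_z`) of the companion series. -/
def bS (k : ℕ) (τ u : ℂ) : ℂ := fSeries (fun n => n ^ k * bCoeff n τ) u

/-- The `δ_q`-derivative of the theta series. -/
def jD (τ u : ℂ) : ℂ := fSeries (coeffDeriv jCoeff τ) u

/-- The `δ_q`-derivative of the companion series. -/
def bD (τ u : ℂ) : ℂ := fSeries (coeffDeriv bCoeff τ) u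

lemma GaussDecay.int_pow_mul {a : ℤ → ℂ} (ha : GaussDecay a) (k : ℕ) :
    GaussDecay fun n => n ^ k * a n := by
  induction k with
  | zero => simpa using ha
  | succ k ih => simpa [pow_succ', mul_assoc] using ih.int_mul

variable {τ : ℂ}

lemma gaussDecay_jCoeff (hτ : 0 < τ.im) : GaussDecay fun n => jCoeff n τ :=
  (gaussDecayAt_jCoeff hτ).self

lemma gaussDecay_bCoeff (hτ : 0 < τ.im) : GaussDecay fun n => bCoeff n τ :=
  (gaussDecayAt_bCoeff hτ).self

lemma gaussDecay_coeffDeriv_jCoeff (hτ : 0 < τ.im) : GaussDecay (coeffDeriv jCoeff τ) :=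
  (gaussDecayAt_jCoeff hτ).deriv.const_mul _

lemma gaussDecay_coeffDeriv_bCoeff (hτ : 0 < τ.im) : GaussDecay (coeffDeriv bCoeff τ) :=
  (gaussDecayAt_bCoeff hτ).deriv.const_mul _

lemma hasDerivAt_jS (hτ : 0 < τ.im) (k : ℕ) (u : ℂ) :
    HasDerivAt (jS k τ) (2 * π * I * jS (k + 1) τ u) u := by
  refine (((gaussDecay_jCoeff hτ).int_pow_mul k).hasDerivAt u).congr_deriv ?_
  simp only [jS, pow_succ', mul_assoc]

lemma hasDerivAt_bS (hτ : 0 < τ.im) (k : ℕ) (u : ℂ) :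
    HasDerivAt (bS k τ) (2 * π * I * bS (k + 1) τ u) u := by
  refine (((gaussDecay_bCoeff hτ).int_pow_mul k).hasDerivAt u).congr_deriv ?_
  simp only [bS, pow_succ', mul_assoc]

lemma hasDerivAt_jS_zero_tau (hτ : 0 < τ.im) (u : ℂ) :
    HasDerivAt (fun t => jS 0 t u) (2 * π * I * jD τ u) τ := by
  have := (gaussDecayAt_jCoeff hτ).hasDerivAt u
  simp only [jS, jD, pow_zero, one_mul]
  refine this.congr_deriv ?_
  unfold coeffDeriv
  rw [fSeries_const_mul, mul_inv_cancel_left₀ Complex.two_pi_I_ne_zero]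

lemma hasDerivAt_bS_zero_tau (hτ : 0 < τ.im) (u : ℂ) :
    HasDerivAt (fun t => bS 0 t u) (2 * π * I * bD τ u) τ := by
  have := (gaussDecayAt_bCoeff hτ).hasDerivAt u
  simp only [bS, bD, pow_zero, one_mul]
  refine this.congr_deriv ?_
  unfold coeffDeriv
  rw [fSeries_const_mul, mul_inv_cancel_left₀ Complex.two_pi_I_ne_zero]

lemma differentiable_jS (hτ : 0 < τ.im) (k : ℕ) : Differentiable ℂ (jS k τ) :=
  fun u => (hasDerivAt_jS hτ k u).differentiableAt

lemma differentiable_bS (hτ : 0 < τ.im) (k : ℕ) : Differentiable ℂ (bS k τ) :=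
  fun u => (hasDerivAt_bS hτ k u).differentiableAt

section Shift

lemma jS_zero_add (hτ : 0 < τ.im) (u : ℂ) :
    jS 0 τ (u + 2 * τ) = -(ex u)⁻¹ * jS 0 τ u := by
  have hj := (gaussDecay_jCoeff hτ).int_pow_mul
  have h := fSeries_add_period (a := fun n => n ^ 0 * jCoeff n τ) (T := 2 * τ)
    ((hj 0).const_mul 0) (hj 0) (fun n => by
      linear_combination jCoeff_shift n τ) u
  rw [fSeries_const_mul] at h
  simp only [jS]
  linear_combination h

lemma jS_one_add (hτ : 0 < τ.im) (u : ℂ) :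
    jS 1 τ (u + 2 * τ) = -(ex u)⁻¹ * (jS 1 τ u - jS 0 τ u) := by
  have hj := (gaussDecay_jCoeff hτ).int_pow_mul
  have h := fSeries_add_period (a := fun n => n ^ 1 * jCoeff n τ) (T := 2 * τ)
    ((hj 0).const_mul 0) ((hj 1).sub (hj 0)) (fun n => by
      push_cast
      linear_combination n * jCoeff_shift n τ) u
  rw [fSeries_const_mul, fSeries_sub (hj 1) (hj 0)] at h
  simp only [jS]
  linear_combination h

lemma jS_two_add (hτ : 0 < τ.im) (u : ℂ) :
    jS 2 τ (u + 2 * τ) = -(ex u)⁻¹ * (jS 2 τ u - 2 * jS 1 τ u + jS 0 τ u) := by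
  have hj := (gaussDecay_jCoeff hτ).int_pow_mul
  have h := fSeries_add_period (a := fun n => n ^ 2 * jCoeff n τ) (T := 2 * τ)
    ((hj 0).const_mul 0) (((hj 2).sub ((hj 1).const_mul 2)).add (hj 0)) (fun n => by
      push_cast
      linear_combination n ^ 2 * jCoeff_shift n τ) u
  rw [fSeries_const_mul, fSeries_add ((hj 2).sub ((hj 1).const_mul 2)) (hj 0),
    fSeries_sub (hj 2) ((hj 1).const_mul 2), fSeries_const_mul] at h
  simp only [jS]
  linear_combination h

lemma jD_add (hτ : 0 < τ.im) (u : ℂ) :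
    jD τ (u + 2 * τ) = -(ex u)⁻¹ * jD τ u - 2 * jS 1 τ (u + 2 * τ) := by
  have hj := (gaussDecay_jCoeff hτ).int_pow_mul
  have hd := gaussDecay_coeffDeriv_jCoeff hτ
  have h := fSeries_add_period (a := fun n => coeffDeriv jCoeff τ n + 2 * (n ^ 1 * jCoeff n τ))
    (T := 2 * τ) ((hj 0).const_mul 0) hd (fun n => by
      linear_combination coeffDeriv_jCoeff_shift n τ) u
  rw [fSeries_const_mul, fSeries_add hd ((hj 1).const_mul 2), fSeries_const_mul] at h
  simp only [jS, jD]
  linear_combination h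

lemma bS_zero_add (hτ : 0 < τ.im) (u : ℂ) :
    bS 0 τ (u + 2 * τ) = ex τ * bS 0 τ u - (ex u)⁻¹ * jS 0 τ u := by
  have hj := (gaussDecay_jCoeff hτ).int_pow_mul
  have hb := (gaussDecay_bCoeff hτ).int_pow_mul
  have h := fSeries_add_period (a := fun n => n ^ 0 * bCoeff n τ) (T := 2 * τ)
    ((hb 0).const_mul (ex τ)) (hj 0) (fun n => by
      linear_combination bCoeff_shift n hτ) u
  rw [fSeries_const_mul] at h
  exact h

lemma bS_one_add (hτ : 0 < τ.im) (u : ℂ) :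
    bS 1 τ (u + 2 * τ) = ex τ * bS 1 τ u - (ex u)⁻¹ * (jS 1 τ u - jS 0 τ u) := by
  have hj := (gaussDecay_jCoeff hτ).int_pow_mul
  have hb := (gaussDecay_bCoeff hτ).int_pow_mul
  have h := fSeries_add_period (a := fun n => n ^ 1 * bCoeff n τ) (T := 2 * τ)
    ((hb 1).const_mul (ex τ)) ((hj 1).sub (hj 0)) (fun n => by
      push_cast
      linear_combination n * bCoeff_shift n hτ) u
  rw [fSeries_const_mul, fSeries_sub (hj 1) (hj 0)] at h
  exact h

lemma bS_two_add (hτ : 0 < τ.im) (u : ℂ) :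
    bS 2 τ (u + 2 * τ) =
      ex τ * bS 2 τ u - (ex u)⁻¹ * (jS 2 τ u - 2 * jS 1 τ u + jS 0 τ u) := by
  have hj := (gaussDecay_jCoeff hτ).int_pow_mul
  have hb := (gaussDecay_bCoeff hτ).int_pow_mul
  have h := fSeries_add_period (a := fun n => n ^ 2 * bCoeff n τ) (T := 2 * τ)
    ((hb 2).const_mul (ex τ)) (((hj 2).sub ((hj 1).const_mul 2)).add (hj 0)) (fun n => by
      push_cast
      linear_combination n ^ 2 * bCoeff_shift n hτ) u
  rw [fSeries_const_mul, fSeries_add ((hj 2).sub ((hj 1).const_mul 2)) (hj 0),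
    fSeries_sub (hj 2) ((hj 1).const_mul 2), fSeries_const_mul] at h
  exact h

lemma bD_add (hτ : 0 < τ.im) (u : ℂ) :
    bD τ (u + 2 * τ) =
      ex τ * (bS 0 τ u + bD τ u) - (ex u)⁻¹ * jD τ u - 2 * bS 1 τ (u + 2 * τ) := by
  have hb := (gaussDecay_bCoeff hτ).int_pow_mul
  have hd := gaussDecay_coeffDeriv_bCoeff hτ
  have h := fSeries_add_period (a := fun n => coeffDeriv bCoeff τ n + 2 * (n ^ 1 * bCoeff n τ))
    (T := 2 * τ) (((hb 0).add hd).const_mul (ex τ)) (gaussDecay_coeffDeriv_jCoeff hτ) (fun n => by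
      linear_combination coeffDeriv_bCoeff_shift hτ n) u
  rw [fSeries_const_mul, fSeries_add (hb 0) hd, fSeries_add hd ((hb 1).const_mul 2),
    fSeries_const_mul] at h
  simp only [bS, bD, jD]
  linear_combination h

end Shift

section Reflection

lemma jS_zero_neg (τ u : ℂ) : jS 0 τ (-u) = -((ex u)⁻¹ * jS 0 τ u) :=
  fSeries_neg (fun n => by linear_combination jCoeff_neg n τ) u

lemma jS_one_neg (hτ : 0 < τ.im) (u : ℂ) :
    jS 1 τ (-u) = (ex u)⁻¹ * (jS 1 τ u - jS 0 τ u) := by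
  have hj := (gaussDecay_jCoeff hτ).int_pow_mul
  have h := fSeries_neg (a := fun n => n ^ 1 * jCoeff n τ)
    (d := fun n => n ^ 0 * jCoeff n τ - n ^ 1 * jCoeff n τ) (fun n => by
      push_cast
      linear_combination -n * jCoeff_neg n τ) u
  rw [fSeries_sub (hj 0) (hj 1)] at h
  simp only [jS]
  linear_combination h

lemma jS_two_neg (hτ : 0 < τ.im) (u : ℂ) :
    jS 2 τ (-u) = -((ex u)⁻¹ * (jS 2 τ u - 2 * jS 1 τ u + jS 0 τ u)) := by
  have hj := (gaussDecay_jCoeff hτ).int_pow_mul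
  have h := fSeries_neg (a := fun n => n ^ 2 * jCoeff n τ)
    (d := fun n => n ^ 2 * jCoeff n τ - 2 * (n ^ 1 * jCoeff n τ) + n ^ 0 * jCoeff n τ) (fun n => by
      push_cast
      linear_combination n ^ 2 * jCoeff_neg n τ) u
  rw [fSeries_add ((hj 2).sub ((hj 1).const_mul 2)) (hj 0),
    fSeries_sub (hj 2) ((hj 1).const_mul 2), fSeries_const_mul] at h
  exact h

lemma jD_neg (τ u : ℂ) : jD τ (-u) = -((ex u)⁻¹ * jD τ u) :=
  fSeries_neg (fun n => coeffDeriv_jCoeff_neg n τ) u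

lemma bS_zero_neg (hτ : 0 < τ.im) (u : ℂ) :
    bS 0 τ (-u) = -((ex u)⁻¹ * (jS 0 τ u - bS 0 τ u)) := by
  have hj := (gaussDecay_jCoeff hτ).int_pow_mul
  have hb := (gaussDecay_bCoeff hτ).int_pow_mul
  have h := fSeries_neg (a := fun n => n ^ 0 * bCoeff n τ)
    (d := fun n => n ^ 0 * jCoeff n τ - n ^ 0 * bCoeff n τ) (fun n => by
      linear_combination bCoeff_neg n hτ) u
  rw [fSeries_sub (hj 0) (hb 0)] at h
  exact h

lemma bS_one_neg (hτ : 0 < τ.im) (u : ℂ) :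
    bS 1 τ (-u) = (ex u)⁻¹ * (jS 1 τ u - jS 0 τ u - (bS 1 τ u - bS 0 τ u)) := by
  have hj := (gaussDecay_jCoeff hτ).int_pow_mul
  have hb := (gaussDecay_bCoeff hτ).int_pow_mul
  have h := fSeries_neg (a := fun n => n ^ 1 * bCoeff n τ)
    (d := fun n => n ^ 0 * jCoeff n τ - n ^ 1 * jCoeff n τ -
      (n ^ 0 * bCoeff n τ - n ^ 1 * bCoeff n τ)) (fun n => by
      push_cast
      linear_combination -n * bCoeff_neg n hτ) u
  rw [fSeries_sub ((hj 0).sub (hj 1)) ((hb 0).sub (hb 1)), fSeries_sub (hj 0) (hj 1),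
    fSeries_sub (hb 0) (hb 1)] at h
  simp only [jS, bS]
  linear_combination h

lemma bS_two_neg (hτ : 0 < τ.im) (u : ℂ) :
    bS 2 τ (-u) = -((ex u)⁻¹ * (jS 2 τ u - 2 * jS 1 τ u + jS 0 τ u -
      (bS 2 τ u - 2 * bS 1 τ u + bS 0 τ u))) := by
  have hj := (gaussDecay_jCoeff hτ).int_pow_mul
  have hb := (gaussDecay_bCoeff hτ).int_pow_mul
  have hj2 := (hj 2).sub ((hj 1).const_mul 2)
  have hb2 := (hb 2).sub ((hb 1).const_mul 2)
  have h := fSeries_neg (a := fun n => n ^ 2 * bCoeff n τ)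
    (d := fun n => n ^ 2 * jCoeff n τ - 2 * (n ^ 1 * jCoeff n τ) + n ^ 0 * jCoeff n τ -
      (n ^ 2 * bCoeff n τ - 2 * (n ^ 1 * bCoeff n τ) + n ^ 0 * bCoeff n τ)) (fun n => by
      push_cast
      linear_combination n ^ 2 * bCoeff_neg n hτ) u
  rw [fSeries_sub (hj2.add (hj 0)) (hb2.add (hb 0)), fSeries_add hj2 (hj 0),
    fSeries_add hb2 (hb 0), fSeries_sub (hj 2) ((hj 1).const_mul 2),
    fSeries_sub (hb 2) ((hb 1).const_mul 2), fSeries_const_mul, fSeries_const_mul] at h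
  exact h

lemma bD_neg (hτ : 0 < τ.im) (u : ℂ) : bD τ (-u) = -((ex u)⁻¹ * (jD τ u - bD τ u)) := by
  have h := fSeries_neg (d := fun n => coeffDeriv jCoeff τ n - coeffDeriv bCoeff τ n)
    (fun n => coeffDeriv_bCoeff_neg hτ n) u
  rw [fSeries_sub (gaussDecay_coeffDeriv_jCoeff hτ) (gaussDecay_coeffDeriv_bCoeff hτ)] at h
  exact h

end Reflection

/-- `J³` times the heat operator `δ_q + δ_z²` applied to `B / J`, where `J` is the theta series and
`B` its companion. -/
def heatNum (τ u : ℂ) : ℂ :=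
  jS 0 τ u ^ 2 * (bD τ u + bS 2 τ u) - jS 0 τ u * bS 0 τ u * (jD τ u + jS 2 τ u) -
    2 * jS 0 τ u * bS 1 τ u * jS 1 τ u + 2 * bS 0 τ u * jS 1 τ u ^ 2

lemma differentiable_heatNum (hτ : 0 < τ.im) : Differentiable ℂ (heatNum τ) := by
  have hj := differentiable_jS hτ
  have hb := differentiable_bS hτ
  have h1 : Differentiable ℂ (jD τ) := (gaussDecay_coeffDeriv_jCoeff hτ).differentiable
  have h2 : Differentiable ℂ (bD τ) := (gaussDecay_coeffDeriv_bCoeff hτ).differentiable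
  exact (((((hj 0).pow 2).mul (h2.add (hb 2))).sub (((hj 0).mul (hb 0)).mul (h1.add (hj 2)))).sub
    ((((hj 0).const_mul 2).mul (hb 1)).mul (hj 1))).add (((hb 0).const_mul 2).mul ((hj 1).pow 2))

lemma heatNum_add_one (τ u : ℂ) : heatNum τ (u + 1) = heatNum τ u := by
  simp only [heatNum, jS, bS, jD, bD, fSeries_add_one]

lemma heatNum_add (hτ : 0 < τ.im) (u : ℂ) :
    heatNum τ (u + 2 * τ) = ex τ * (ex u)⁻¹ ^ 2 * heatNum τ u := by
  simp only [heatNum]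
  rw [bD_add hτ, jD_add hτ, jS_zero_add hτ, jS_one_add hτ, jS_two_add hτ, bS_zero_add hτ,
    bS_one_add hτ, bS_two_add hτ]
  ring

lemma heatNum_neg (hτ : 0 < τ.im) (u : ℂ) :
    heatNum τ (-u) = (ex u)⁻¹ ^ 3 * heatNum τ u := by
  simp only [heatNum]
  rw [bD_neg hτ, jD_neg, jS_zero_neg, jS_one_neg hτ, jS_two_neg hτ, bS_zero_neg hτ,
    bS_one_neg hτ, bS_two_neg hτ]
  ring

lemma heatNum_half (hτ : 0 < τ.im) : heatNum τ (1 / 2) = 0 := by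
  have h1 := heatNum_neg hτ (1 / 2)
  have h2 := heatNum_add_one τ (-(1 / 2))
  rw [ex_half] at h1
  norm_num at h1 h2 ⊢
  exact self_eq_neg.1 (h2.trans h1)

lemma heatNum_half_add (hτ : 0 < τ.im) : heatNum τ (1 / 2 + τ) = 0 := by
  have h1 := heatNum_neg hτ (1 / 2 + τ)
  have h2 := heatNum_add_one τ (-(1 / 2 + τ) + 2 * τ)
  have h3 := heatNum_add hτ (-(1 / 2 + τ))
  rw [show -(1 / 2 + τ) + 2 * τ + 1 = 1 / 2 + τ by ring, h3, h1, ex_neg, ex_add, ex_half] at h2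
  have := ex_ne_zero τ
  generalize heatNum τ (1 / 2 + τ) = x at *
  field_simp at h2
  exact self_eq_neg.1 (by linear_combination h2)

lemma heatNum_eq_zero (hτ : 0 < τ.im) (m n : ℤ) : heatNum τ (m * τ + n + 1 / 2) = 0 := by
  have key : ∀ v, heatNum τ v = 0 → ∀ m n : ℤ, heatNum τ (m * (2 * τ) + n + v) = 0 := by
    intro v hv
    refine lattice_induction (P := fun u => heatNum τ (u + v) = 0) (by simpa using hv)
      (fun u => ?_) (fun u => ?_)
    · rw [show u + 1 + v = u + v + 1 by ring, heatNum_add_one]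
    · rw [show u + 2 * τ + v = u + v + 2 * τ by ring, heatNum_add hτ]
      simp [ex_ne_zero]
  rcases Int.even_or_odd' m with ⟨k, rfl | rfl⟩
  · have := key _ (heatNum_half hτ) k n
    convert this using 2; push_cast; ring
  · have := key _ (heatNum_half_add hτ) k n
    convert this using 2; push_cast; ring

/-- The numerator `heatNum` is a constant multiple of `z (-z;q)_∞ (-q/z;q)_∞`. -/
lemma exists_heatNum_eq (hτ : 0 < τ.im) :
    ∃ c, ∀ u, heatNum τ u = c * (ex u * thetaProd τ (u + 1 / 2)) := by
  have h2τ : 0 < (2 * τ).im := by simpa using hτ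
  obtain ⟨c, hc⟩ := exists_eq_const_mul_thetaProd hτ h2τ
    (X := fun v => heatNum τ (v + 1 / 2)) (w := ex) (c₁ := fun _ => 1)
    (c₂ := fun v => ex τ * (ex v)⁻¹ ^ 2)
    ((differentiable_heatNum hτ).comp (differentiable_id.add_const _)) differentiable_ex ex_ne_zero
    (heatNum_eq_zero hτ) (fun _ => one_ne_zero)
    (fun v => mul_ne_zero (ex_ne_zero _) (pow_ne_zero _ (inv_ne_zero (ex_ne_zero _))))
    (fun v => by
      rw [show v + 1 + 1 / 2 = v + 1 / 2 + 1 by ring, heatNum_add_one, one_mul])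
    (fun v => by
      rw [show v + 2 * τ + 1 / 2 = v + 1 / 2 + 2 * τ by ring, heatNum_add hτ, ex_add v, ex_half]
      ring)
    (fun v => by rw [ex_add, ex_one, thetaProd_add_one]; ring)
    (fun v => by
      have h1 := ex_ne_zero v
      have h2 := ex_ne_zero τ
      rw [show v + 2 * τ = v + τ + τ by ring, thetaProd_add hτ, thetaProd_add hτ, ex_add, ex_add]
      field_simp)
  refine ⟨-c, fun u => ?_⟩
  have := hc (u + 1 / 2)
  rw [show u + 1 / 2 + 1 / 2 = u + 1 by ring, heatNum_add_one, ex_add, ex_half] at this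
  rw [this]; ring

/-- The theta series is a non-zero multiple of `(z;q²)_∞ (q²/z;q²)_∞`. -/
lemma exists_jS_eq (hτ : 0 < τ.im) :
    ∃ c, c ≠ 0 ∧ ∀ u, jS 0 τ u = c * thetaProd (2 * τ) u := by
  have h2τ : 0 < (2 * τ).im := by simpa using hτ
  have h1 : ∀ u, jS 0 τ (u + 1) = jS 0 τ u := fun u => fSeries_add_one _ u
  have h0 : jS 0 τ 0 = 0 := by
    have := jS_zero_neg τ 0
    rw [ex_zero, neg_zero, inv_one, one_mul] at this
    exact self_eq_neg.1 this
  obtain ⟨c, hc⟩ := exists_eq_const_mul_thetaProd h2τ h2τ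
    (X := jS 0 τ) (w := fun _ => 1) (c₁ := fun _ => 1) (c₂ := fun v => -(ex v)⁻¹)
    (differentiable_jS hτ 0) (differentiable_const 1) (fun _ => one_ne_zero)
    (lattice_induction (P := fun u => jS 0 τ u = 0) h0 (fun u => by rw [h1]) fun u => by
      rw [jS_zero_add hτ]; simp [ex_ne_zero])
    (fun _ => one_ne_zero) (fun v => neg_ne_zero.2 (inv_ne_zero (ex_ne_zero _)))
    (fun v => by rw [h1, one_mul]) (jS_zero_add hτ)
    (fun v => by rw [thetaProd_add_one, one_mul, one_mul])
    (fun v => by rw [thetaProd_add h2τ, one_mul, one_mul])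
  refine ⟨c, ?_, fun u => by rw [hc, one_mul]⟩
  rintro rfl
  have := (gaussDecay_jCoeff hτ).coeff_zero fun u => by
    have := hc u
    simpa [jS] using this
  simp [jCoeff, ex_zero] at this

end Wronskian

section RankSeries

variable {τ : ℂ}

lemma two_mul_im_pos (hτ : 0 < τ.im) : 0 < (2 * τ).im := by simpa using hτ

lemma exists_norm_m2Coeff_le {q : ℂ} (hq : ‖q‖ < 1) : ∃ C, ∀ n, ‖m2Coeff q n‖ ≤ C * ‖q‖ ^ n := by
  have hp := norm_sq_lt_one hq
  obtain ⟨A, hA⟩ := exists_norm_qPochN_le hp (-1)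
  obtain ⟨B, hB⟩ := exists_norm_qPochN_le hp (-q)
  refine ⟨A * B, fun n => ?_⟩
  rw [m2Coeff, norm_mul, norm_mul, norm_pow]
  have hA0 : 0 ≤ A := (norm_nonneg _).trans (hA 0)
  gcongr
  · exact hA n
  · exact hB n

lemma m2Coeff_succ (q : ℂ) (n : ℕ) : m2Coeff q (n + 1) =
    m2Coeff q n * (q * (1 + (q ^ 2) ^ n) * (1 + q * (q ^ 2) ^ n)) := by
  simp only [m2Coeff, qPochN_succ, pow_succ q n]
  ring

/-- A common bound for the two `q²`-Pochhammer factors over a horizontal strip. -/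
lemma exists_norm_factor_le {p : ℂ} (hp : ‖p‖ < 1) (R : ℝ) :
    ∃ C, 0 ≤ C ∧ ∀ u x : ℂ, |u.im| ≤ R → ‖x‖ ≤ 1 →
      ‖qPochInf (ex u * x) p‖ ≤ C ∧ ‖qPochInf ((ex u)⁻¹ * x) p‖ ≤ C := by
  obtain ⟨C, hC0, hC⟩ := exists_norm_qPochInf_le hp (Real.exp (2 * π * R))
  have key : ∀ u : ℂ, |u.im| ≤ R → ‖ex u‖ ≤ Real.exp (2 * π * R) := fun u hu => by
    have := norm_ex_int_mul_le hu 1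
    simpa using this
  refine ⟨C, hC0, fun u x hu hx => ⟨hC _ ?_, hC _ ?_⟩⟩
  · rw [norm_mul]
    exact (mul_le_of_le_one_right (norm_nonneg _) hx).trans (key u hu)
  · rw [norm_mul, ← ex_neg]
    exact (mul_le_of_le_one_right (norm_nonneg _) hx).trans (key (-u) (by simpa using hu))

/-- The M2-rank generating function after clearing denominators. -/
def nNum (τ u : ℂ) : ℂ :=
  ∑' n : ℕ, m2Coeff (ex τ) n * (qPochInf (ex u * (ex τ ^ 2) ^ (n + 1)) (ex τ ^ 2) *
    qPochInf ((ex u)⁻¹ * (ex τ ^ 2) ^ (n + 1)) (ex τ ^ 2))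

lemma norm_pow_le_one_of_lt {p : ℂ} (hp : ‖p‖ < 1) (n : ℕ) : ‖p ^ n‖ ≤ 1 := by
  rw [norm_pow]; exact pow_le_one₀ (norm_nonneg _) hp.le

lemma exists_summable_bound (hτ : 0 < τ.im) (R : ℝ) :
    ∃ s : ℕ → ℝ, Summable s ∧ ∀ (n : ℕ) (u x y : ℂ), |u.im| ≤ R → ‖x‖ ≤ 1 → ‖y‖ ≤ 1 →
      ‖m2Coeff (ex τ) n * (qPochInf (ex u * x) (ex τ ^ 2) *
        qPochInf ((ex u)⁻¹ * y) (ex τ ^ 2))‖ ≤ s n := by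
  have hq := norm_ex_lt_one hτ
  obtain ⟨A, hA⟩ := exists_norm_m2Coeff_le hq
  obtain ⟨C, hC0, hC⟩ := exists_norm_factor_le (norm_sq_lt_one hq) R
  refine ⟨fun n => A * ‖ex τ‖ ^ n * (C * C),
    ((summable_geometric_of_lt_one (norm_nonneg _) hq).mul_left A).mul_right _,
    fun n u x y hu hx hy => ?_⟩
  rw [norm_mul, norm_mul]
  exact mul_le_mul (hA n) (mul_le_mul (hC u x hu hx).1 (hC u y hu hy).2 (norm_nonneg _) hC0)
    (by positivity) ((norm_nonneg _).trans (hA n))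

lemma differentiable_nNum (hτ : 0 < τ.im) : Differentiable ℂ (nNum τ) := by
  intro u
  have hq2 := norm_sq_lt_one (norm_ex_lt_one hτ)
  obtain ⟨s, hs, hb⟩ := exists_summable_bound hτ (|u.im| + 1)
  have ho := isOpen_abs_im_lt (|u.im| + 1)
  have hu : u ∈ {w : ℂ | |w.im| < |u.im| + 1} := lt_add_one |u.im|
  refine (differentiableOn_tsum_of_summable_norm hs (fun n => ?_) ho (fun n w hw =>
    hb n w _ _ (le_of_lt hw) (norm_pow_le_one_of_lt hq2 _) (norm_pow_le_one_of_lt hq2 _))).differentiableAt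
      (ho.mem_nhds hu)
  have h1 := differentiable_qPochInf_ex (two_mul_im_pos hτ) ((ex τ ^ 2) ^ (n + 1))
  have h2 := differentiable_qPochInf_ex_inv (two_mul_im_pos hτ) ((ex τ ^ 2) ^ (n + 1))
  rw [ex_two_mul] at h1 h2
  exact ((h1.mul h2).const_mul _).differentiableOn

lemma nNum_add_one (τ u : ℂ) : nNum τ (u + 1) = nNum τ u := by
  simp [nNum, ex_add, ex_one]

lemma nNum_zero (hτ : 0 < τ.im) :
    nNum τ 0 = qPochInf (ex τ ^ 2) (ex τ ^ 2) * qPochInf (-ex τ) (ex τ) ^ 2 := by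
  rw [← tsum_m2Coeff_mul_sq (norm_ex_lt_one hτ), nNum]
  simp [ex_zero]

lemma nStarM2over_eq (hτ : 0 < τ.im) {u : ℂ} (hu : thetaProd (2 * τ) u ≠ 0) :
    nStarM2over (ex u) (ex τ) = nNum τ u / thetaProd (2 * τ) u := by
  have hq2 := norm_sq_lt_one (norm_ex_lt_one hτ)
  have hθ := thetaProd_eq (two_mul_im_pos hτ) u
  rw [ex_two_mul] at hθ
  rw [hθ] at hu ⊢
  obtain ⟨h1, h2⟩ := mul_ne_zero_iff.1 hu
  obtain ⟨h3, h4⟩ := mul_ne_zero_iff.1 h2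
  have e : nNum τ u / (qPochInf (ex u * ex τ ^ 2) (ex τ ^ 2) *
      qPochInf ((ex u)⁻¹ * ex τ ^ 2) (ex τ ^ 2)) = nGenM2over (ex u) (ex τ) := by
    rw [nNum, nGenM2over, ← tsum_div_const]
    refine tsum_congr fun n => ?_
    have e1 := qPochInf_eq_qPochN_mul hq2 (ex u * ex τ ^ 2) n
    have e2 := qPochInf_eq_qPochN_mul hq2 ((ex u)⁻¹ * ex τ ^ 2) n
    rw [mul_assoc, ← pow_succ'] at e1 e2
    rw [e1] at h3 ⊢
    rw [e2] at h4 ⊢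
    obtain ⟨h5, h6⟩ := mul_ne_zero_iff.1 h3
    obtain ⟨h7, h8⟩ := mul_ne_zero_iff.1 h4
    rw [m2Coeff, div_eq_div_iff (mul_ne_zero h3 h4) (mul_ne_zero h5 h7)]
    ring
  rw [nStarM2over, ← e, div_div, mul_comm (1 - ex u)]

lemma nNum_add (hτ : 0 < τ.im) (u : ℂ) :
    ex τ * ((1 + ex u) * nNum τ u) - (1 + ex (u + 2 * τ)) * nNum τ (u + 2 * τ) =
      (1 - ex τ * ex u) * ((ex u)⁻¹ * thetaProd (2 * τ) u) := by
  have hq2 := norm_sq_lt_one (norm_ex_lt_one hτ)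
  have hz := ex_ne_zero u
  have hq0 := ex_ne_zero τ
  obtain ⟨s, hs, hb⟩ := exists_summable_bound hτ |u.im|
  have hsum : ∀ f g : ℕ → ℂ, (∀ n, ‖f n‖ ≤ 1) → (∀ n, ‖g n‖ ≤ 1) → Summable fun n =>
      m2Coeff (ex τ) n * (qPochInf (ex u * f n) (ex τ ^ 2) *
        qPochInf ((ex u)⁻¹ * g n) (ex τ ^ 2)) := fun f g hf hg =>
    hs.of_norm_bounded fun n => hb n u _ _ le_rfl (hf n) (hg n)
  have hpow := norm_pow_le_one_of_lt hq2
  have hN := hsum (fun n => (ex τ ^ 2) ^ (n + 1)) (fun n => (ex τ ^ 2) ^ (n + 1))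
    (fun n => hpow _) (fun n => hpow _)
  have hN' := hsum (fun n => (ex τ ^ 2) ^ (n + 2)) (fun n => (ex τ ^ 2) ^ n)
    (fun n => hpow _) (fun n => hpow _)
  have hG := hsum (fun n => (ex τ ^ 2) ^ (n + 1)) (fun n => (ex τ ^ 2) ^ n)
    (fun n => hpow _) (fun n => hpow _)
  have eN' : nNum τ (u + 2 * τ) = ∑' n, m2Coeff (ex τ) n *
      (qPochInf (ex u * (ex τ ^ 2) ^ (n + 2)) (ex τ ^ 2) *
        qPochInf ((ex u)⁻¹ * (ex τ ^ 2) ^ n) (ex τ ^ 2)) := by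
    refine tsum_congr fun n => ?_
    have e1 : ex (u + 2 * τ) * (ex τ ^ 2) ^ (n + 1) = ex u * (ex τ ^ 2) ^ (n + 2) := by
      rw [ex_add, ex_two_mul]; ring
    have e2 : (ex (u + 2 * τ))⁻¹ * (ex τ ^ 2) ^ (n + 1) = (ex u)⁻¹ * (ex τ ^ 2) ^ n := by
      rw [ex_add, ex_two_mul]; field_simp; ring
    rw [e1, e2]
  have ht := tsum_telescope hG
  have hθ : (ex u)⁻¹ * thetaProd (2 * τ) u = -(m2Coeff (ex τ) 0 *
      (qPochInf (ex u * (ex τ ^ 2) ^ (0 + 1)) (ex τ ^ 2) *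
        qPochInf ((ex u)⁻¹ * (ex τ ^ 2) ^ 0) (ex τ ^ 2))) := by
    rw [thetaProd_eq (two_mul_im_pos hτ), ex_two_mul, pow_zero, mul_one,
      qPochInf_eq_mul hq2 (ex u)⁻¹]
    simp [m2Coeff, qPochN]
    field_simp
    ring
  rw [hθ, ← ht, eN', nNum, ← mul_assoc, ← tsum_mul_left, ← tsum_mul_left, ← tsum_mul_left,
    ← (hN.mul_left _).tsum_sub (hN'.mul_left _)]
  refine tsum_congr fun n => ?_
  have e1 := qPochInf_eq_mul hq2 (ex u * (ex τ ^ 2) ^ (n + 1))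
  have e2 := qPochInf_eq_mul hq2 ((ex u)⁻¹ * (ex τ ^ 2) ^ n)
  rw [mul_assoc, ← pow_succ] at e1 e2
  rw [e1, e2, m2Coeff_succ, ex_add, ex_two_mul]
  field_simp
  ring

/-- The M2-rank series in terms of the theta series and its companion. -/
lemma mul_nNum_eq (hτ : 0 < τ.im) {κ : ℂ} (hκ : ∀ u, jS 0 τ u = κ * thetaProd (2 * τ) u) (u : ℂ) :
    κ * ((1 + ex u) * nNum τ u) = 2 * bS 0 τ u - jS 0 τ u := by
  set X : ℂ → ℂ := fun u => κ * ((1 + ex u) * nNum τ u) - (2 * bS 0 τ u - jS 0 τ u) with hX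
  have hXd : Differentiable ℂ X :=
    (((differentiable_ex.const_add 1).mul (differentiable_nNum hτ)).const_mul κ).sub
      (((differentiable_bS hτ 0).const_mul 2).sub (differentiable_jS hτ 0))
  have h1 : ∀ u, X (u + 1) = X u := fun u => by
    simp only [hX, nNum_add_one, jS, bS, fSeries_add_one, ex_add, ex_one, mul_one]
  have h2 : ∀ u, X (u + 2 * τ) = ex τ * X u := fun u => by
    have hz := ex_ne_zero u
    simp only [hX]
    rw [bS_zero_add hτ, jS_zero_add hτ]
    have h3 := nNum_add hτ u
    have h4 := hκ u
    have h5 : ex u * (ex u)⁻¹ = 1 := mul_inv_cancel₀ hz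
    linear_combination -κ * h3 + ((1 - ex τ * ex u) * (ex u)⁻¹) * h4 + ex τ * jS 0 τ u * h5
  have hh : ex (1 / 2) = -1 := ex_half
  have h3 := eq_zero_of_antiperiodic (g := fun u => ex (-(1 / 2 * u)) * X u) (two_mul_im_pos hτ)
    ((differentiable_ex.comp (differentiable_id.const_mul _).neg).mul hXd)
    (fun u => by
      rw [h1, mul_add, neg_add, ex_add, mul_one, ex_neg (1 / 2), hh]
      norm_num)
    (fun u => by
      rw [h2, mul_add, neg_add, ex_add, ex_neg (1 / 2 * (2 * τ)),
        show (1 / 2 * (2 * τ)) = τ by ring]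
      have := ex_ne_zero τ
      field_simp) u
  exact sub_eq_zero.1 ((mul_eq_zero.1 h3).resolve_left (ex_ne_zero _))

end RankSeries

section Pde

variable {τ : ℂ}

lemma crankStar_eq {T : ℂ} (hT : 0 < T.im) {u : ℂ} (hu : thetaProd T u ≠ 0) :
    crankStar (ex u) (ex T) = qPochInf (ex T) (ex T) / thetaProd T u := by
  have hp := norm_ex_lt_one hT
  have hθ := thetaProd_eq hT u
  rw [hθ] at hu ⊢
  obtain ⟨-, h2⟩ := mul_ne_zero_iff.1 hu
  obtain ⟨h3, h4⟩ := mul_ne_zero_iff.1 h2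
  have hm := multipliable_qPoch hp
  have e : ∏' n : ℕ, ((1 - ex T ^ (n + 1)) /
      ((1 - ex u * ex T ^ (n + 1)) * (1 - (ex u)⁻¹ * ex T ^ (n + 1)))) =
      qPochInf (ex T) (ex T) /
        (qPochInf (ex u * ex T) (ex T) * qPochInf ((ex u)⁻¹ * ex T) (ex T)) := by
    have hd := (hm (ex u * ex T)).hasProd.mul (hm ((ex u)⁻¹ * ex T)).hasProd
    have := (hm (ex T)).hasProd.div₀ hd (mul_ne_zero h3 h4)
    rw [← qPochInf, ← qPochInf, ← qPochInf] at this
    rw [← this.tprod_eq]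
    refine tprod_congr fun n => ?_
    simp only [mul_assoc, ← pow_succ']
  rw [crankStar, e, inv_mul_eq_div, div_div, mul_comm _ (1 - ex u)]

/-- The value of the constant relating `heatNum` to the theta product. -/
lemma heatNum_eq (hτ : 0 < τ.im) {κ : ℂ}
    (hκ : ∀ u, jS 0 τ u = κ * thetaProd (2 * τ) u) (u : ℂ) :
    heatNum τ u = κ ^ 3 * qPochInf (ex τ ^ 2) (ex τ ^ 2) ^ 5 *
      (ex u * thetaProd τ (u + 1 / 2)) := by
  obtain ⟨c, hc⟩ := exists_heatNum_eq hτ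
  have hq := norm_ex_lt_one hτ
  have hP : qPochInf (-ex τ) (ex τ) ≠ 0 := qPochInf_ne_zero_of_norm_lt hq (by simpa using hq)
  have hj0 : jS 0 τ 0 = 0 := by
    rw [hκ, (thetaProd_eq_zero_iff (two_mul_im_pos hτ) 0).2 ⟨0, 0, by simp⟩, mul_zero]
  have hj1 : jS 1 τ 0 = -(κ * qPochInf (ex τ ^ 2) (ex τ ^ 2) ^ 2) := by
    have h1 := hasDerivAt_jS hτ 0 0
    have h2 := (hasDerivAt_thetaProd_zero (two_mul_im_pos hτ)).const_mul κ
    rw [← funext hκ] at h2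
    have h3 := h1.unique h2
    rw [ex_two_mul] at h3
    refine mul_left_cancel₀ Complex.two_pi_I_ne_zero ?_
    linear_combination h3
  have hb := mul_nNum_eq hτ hκ 0
  rw [nNum_zero hτ, ex_zero, hj0] at hb
  have h0 := hc 0
  have hθ : thetaProd τ (0 + 1 / 2) = 2 * qPochInf (-ex τ) (ex τ) ^ 2 := by
    rw [zero_add, thetaProd_eq hτ, ex_half]
    norm_num
    ring
  rw [heatNum, hθ, ex_zero, hj0, hj1] at h0
  have hcv : c = κ ^ 3 * qPochInf (ex τ ^ 2) (ex τ ^ 2) ^ 5 := by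
    refine mul_right_cancel₀ (mul_ne_zero two_ne_zero (pow_ne_zero 2 hP)) ?_
    linear_combination -h0 - κ ^ 2 * qPochInf (ex τ ^ 2) (ex τ ^ 2) ^ 4 * hb
  rw [hc, hcv]

lemma one_add_mul_nStarM2over (hτ : 0 < τ.im) {u : ℂ} (hu : jS 0 τ u ≠ 0) :
    (1 + ex u) * nStarM2over (ex u) (ex τ) = 2 * (bS 0 τ u / jS 0 τ u) - 1 := by
  obtain ⟨κ, hκ0, hκ⟩ := exists_jS_eq hτ
  have hN := mul_nNum_eq hτ hκ u
  have hθ : thetaProd (2 * τ) u ≠ 0 := fun h => hu (by rw [hκ, h, mul_zero])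
  rw [hκ] at hN ⊢
  rw [nStarM2over_eq hτ hθ]
  field_simp
  linear_combination hN

lemma deriv_tau_eq (hτ : 0 < τ.im) {u : ℂ} (hu : jS 0 τ u ≠ 0) :
    (1 + ex u) * deriv (fun t => nStarM2over (ex u) (ex t)) τ =
      2 * (2 * π * I) * ((bD τ u * jS 0 τ u - bS 0 τ u * jD τ u) / jS 0 τ u ^ 2) := by
  have hj := hasDerivAt_jS_zero_tau hτ u
  have hb := hasDerivAt_bS_zero_tau hτ u
  have he : (fun t => (1 + ex u) * nStarM2over (ex u) (ex t)) =ᶠ[nhds τ]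
      fun t => 2 * (bS 0 t u / jS 0 t u) - 1 := by
    filter_upwards [eventually_im_pos hτ, hj.continuousAt.eventually_ne hu] with t ht htu
    exact one_add_mul_nStarM2over ht htu
  rw [← deriv_const_mul_field, he.deriv_eq]
  refine (((hb.div hj hu).const_mul 2).sub_const 1).deriv.trans ?_
  ring

lemma deriv_elliptic_eq (hτ : 0 < τ.im) {u : ℂ} (hu : jS 0 τ u ≠ 0) :
    ex u * nStarM2over (ex u) (ex τ) +
        2 * ex u * ((2 * π * I)⁻¹ * deriv (fun w => nStarM2over (ex w) (ex τ)) u) +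
        (1 + ex u) * (2 * π * I)⁻¹ ^ 2 *
          iteratedDeriv 2 (fun w => nStarM2over (ex w) (ex τ)) u =
      2 * ((jS 0 τ u ^ 2 * bS 2 τ u - jS 0 τ u * bS 0 τ u * jS 2 τ u -
        2 * jS 0 τ u * bS 1 τ u * jS 1 τ u + 2 * bS 0 τ u * jS 1 τ u ^ 2) / jS 0 τ u ^ 3) := by
  have h2 := Complex.two_pi_I_ne_zero
  set F : ℂ → ℂ := fun w => nStarM2over (ex w) (ex τ) with hF
  set S : Set ℂ := {w | jS 0 τ w ≠ 0} with hS
  have hSo : IsOpen S := isOpen_ne_fun (differentiable_jS hτ 0).continuous continuous_const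
  obtain ⟨κ, hκ0, hκ⟩ := exists_jS_eq hτ
  have hθ : ∀ w ∈ S, thetaProd (2 * τ) w ≠ 0 := fun w hw h => hw (by rw [hκ, h, mul_zero])
  have hFd : DifferentiableOn ℂ F S := by
    refine DifferentiableOn.congr (f := fun w => nNum τ w / thetaProd (2 * τ) w)
      ((differentiable_nNum hτ).differentiableOn.div
        (differentiable_thetaProd (two_mul_im_pos hτ)).differentiableOn hθ)
      fun w hw => nStarM2over_eq hτ (hθ w hw)
  have hF1 : ∀ w ∈ S, HasDerivAt F (deriv F w) w := fun w hw =>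
    (hFd.differentiableAt (hSo.mem_nhds hw)).hasDerivAt
  have hF2 : HasDerivAt (deriv F) (deriv (deriv F) u) u :=
    ((hFd.deriv hSo).differentiableAt (hSo.mem_nhds hu)).hasDerivAt
  have key1 : ∀ w ∈ S, 2 * π * I * ex w * F w + (1 + ex w) * deriv F w =
      2 * (2 * π * I) *
        ((bS 1 τ w * jS 0 τ w - bS 0 τ w * jS 1 τ w) / jS 0 τ w ^ 2) := fun w hw => by
    have e1 := ((hasDerivAt_ex w).const_add 1).mul (hF1 w hw)
    have e2 := (((hasDerivAt_bS hτ 0 w).div (hasDerivAt_jS hτ 0 w) hw).const_mul 2).sub_const 1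
    have he : (fun w => (1 + ex w) * F w) =ᶠ[nhds w]
        fun w => 2 * (bS 0 τ w / jS 0 τ w) - 1 := by
      filter_upwards [hSo.mem_nhds hw] with v hv
      exact one_add_mul_nStarM2over hτ hv
    have e3 := (e2.congr_of_eventuallyEq he).unique e1
    linear_combination -e3
  have key2 : (2 * π * I) ^ 2 * ex u * F u + 2 * (2 * π * I) * ex u * deriv F u +
      (1 + ex u) * deriv (deriv F) u = (2 * π * I) ^ 2 *
      (2 * ((jS 0 τ u ^ 2 * bS 2 τ u - jS 0 τ u * bS 0 τ u * jS 2 τ u -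
        2 * jS 0 τ u * bS 1 τ u * jS 1 τ u + 2 * bS 0 τ u * jS 1 τ u ^ 2) / jS 0 τ u ^ 3)) := by
    have hj := hasDerivAt_jS hτ
    have hb := hasDerivAt_bS hτ
    have e1 := (((hasDerivAt_ex u).const_mul (2 * π * I)).mul (hF1 u hu)).add
      (((hasDerivAt_ex u).const_add 1).mul hF2)
    have e2 := ((((hb 1 u).mul (hj 0 u)).sub ((hb 0 u).mul (hj 1 u))).div
      ((hj 0 u).pow 2) (pow_ne_zero 2 hu)).const_mul (2 * (2 * π * I))
    have he : (fun w => 2 * π * I * ex w * F w + (1 + ex w) * deriv F w) =ᶠ[nhds u]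
        fun w => 2 * (2 * π * I) *
          ((bS 1 τ w * jS 0 τ w - bS 0 τ w * jS 1 τ w) / jS 0 τ w ^ 2) := by
      filter_upwards [hSo.mem_nhds hu] with v hv using key1 v hv
    have e3 := (e2.congr_of_eventuallyEq he).unique e1
    have hu' : jS 0 τ u ≠ 0 := hu
    refine Eq.trans ?_ (e3.symm.trans ?_)
    · ring
    · simp only [Pi.mul_apply, Pi.sub_apply, Pi.pow_apply]
      field_simp
      norm_num
      ring
  rw [show iteratedDeriv 2 F u = deriv (deriv F) u by rw [iteratedDeriv_succ, iteratedDeriv_one]]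
  refine mul_left_cancel₀ (pow_ne_zero 2 h2) ?_
  rw [← key2]
  change _ * (ex u * F u + _ + _) = _
  field_simp

end Pde

/-- The M2-rank for overpartitions Rank–Crank type PDE. -/
theorem m2_overpartition_pde (τ u : ℂ) (hτ : 0 < τ.im)
    (hu : ∀ m n : ℤ, u ≠ 2 * (m : ℂ) * τ + (n : ℂ)) :
    2 * Complex.exp (2 * π * I * u) *
        qPochInf (Complex.exp (2 * π * I * τ) ^ 2) (Complex.exp (2 * π * I * τ) ^ 2) ^ 2 *
        crankStar (Complex.exp (2 * π * I * u)) (Complex.exp (2 * π * I * τ) ^ 2) ^ 3 *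
        qPochInf (-Complex.exp (2 * π * I * u)) (Complex.exp (2 * π * I * τ)) *
        qPochInf (-(Complex.exp (2 * π * I * u))⁻¹ * Complex.exp (2 * π * I * τ))
          (Complex.exp (2 * π * I * τ))
    = (1 + Complex.exp (2 * π * I * u)) * ((2 * π * I)⁻¹ *
          deriv (fun t : ℂ =>
            nStarM2over (Complex.exp (2 * π * I * u)) (Complex.exp (2 * π * I * t))) τ)
      + Complex.exp (2 * π * I * u) *
          nStarM2over (Complex.exp (2 * π * I * u)) (Complex.exp (2 * π * I * τ))
      + 2 * Complex.exp (2 * π * I * u) * ((2 * π * I)⁻¹ *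
          deriv (fun w : ℂ =>
            nStarM2over (Complex.exp (2 * π * I * w)) (Complex.exp (2 * π * I * τ))) u)
      + (1 + Complex.exp (2 * π * I * u)) * ((2 * π * I)⁻¹)^2 *
          iteratedDeriv 2 (fun w : ℂ =>
            nStarM2over (Complex.exp (2 * π * I * w)) (Complex.exp (2 * π * I * τ))) u := by
  change 2 * ex u * qPochInf (ex τ ^ 2) (ex τ ^ 2) ^ 2 * crankStar (ex u) (ex τ ^ 2) ^ 3 *
      qPochInf (-ex u) (ex τ) * qPochInf (-(ex u)⁻¹ * ex τ) (ex τ) =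
    (1 + ex u) * ((2 * π * I)⁻¹ * deriv (fun t => nStarM2over (ex u) (ex t)) τ) +
      ex u * nStarM2over (ex u) (ex τ) +
      2 * ex u * ((2 * π * I)⁻¹ * deriv (fun w => nStarM2over (ex w) (ex τ)) u) +
      (1 + ex u) * (2 * π * I)⁻¹ ^ 2 * iteratedDeriv 2 (fun w => nStarM2over (ex w) (ex τ)) u
  have h2 := Complex.two_pi_I_ne_zero
  obtain ⟨κ, hκ0, hκ⟩ := exists_jS_eq hτ
  have hθ : thetaProd (2 * τ) u ≠ 0 := fun h => by
    obtain ⟨m, n, hmn⟩ := (thetaProd_eq_zero_iff (two_mul_im_pos hτ) u).1 h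
    exact hu m n (by rw [hmn]; ring)
  have hj : jS 0 τ u ≠ 0 := by rw [hκ]; exact mul_ne_zero hκ0 hθ
  have hR : 2 * heatNum τ u / jS 0 τ u ^ 3 =
      (1 + ex u) * ((2 * π * I)⁻¹ * deriv (fun t => nStarM2over (ex u) (ex t)) τ) +
      (ex u * nStarM2over (ex u) (ex τ) +
      2 * ex u * ((2 * π * I)⁻¹ * deriv (fun w => nStarM2over (ex w) (ex τ)) u) +
      (1 + ex u) * (2 * π * I)⁻¹ ^ 2 *
        iteratedDeriv 2 (fun w => nStarM2over (ex w) (ex τ)) u) := by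
    rw [deriv_elliptic_eq hτ hj, mul_left_comm, deriv_tau_eq hτ hj, heatNum]
    field_simp
    ring
  have hL : 2 * heatNum τ u / jS 0 τ u ^ 3 =
      2 * ex u * qPochInf (ex τ ^ 2) (ex τ ^ 2) ^ 2 * crankStar (ex u) (ex τ ^ 2) ^ 3 *
        qPochInf (-ex u) (ex τ) * qPochInf (-(ex u)⁻¹ * ex τ) (ex τ) := by
    have hC := crankStar_eq (two_mul_im_pos hτ) hθ
    rw [ex_two_mul] at hC
    rw [hC, heatNum_eq hτ hκ, hκ, thetaProd, ex_add, ex_half, mul_neg_one, inv_neg]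
    field_simp
  rw [← hL, hR]
  ring

end
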